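/- arXiv:1702.03270 — 5 statements merged into one kernel-verified Lean document; each statement's English description precedes it below -/
import Mathlib

section
/- Let R be a countable commutative noetherian ring. Then R has full cosupport; that is, for every prime ideal p of R there exists an integer i ≥ 0 such that Ext^i_R(R_p, Λ^p R) ≠ 0. -/
/-!
STATEMENT 0: Every countable commutative noetherian ring has full cosupport:
for every prime ideal `p` of `R` there is some `i ≥ 0` with
`Ext^i_R(R_p, Λ^p R) ≠ 0`, where `R_p` is the localization at `p` and
`Λ^p R` is the `p`-adic completion of `R`.
-/

open CategoryTheory Opposite

universe u

/-- The cosupport of a commutative ring `R`, as a subset of `Spec R`: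
the primes `p` such that `Ext^i_R(R_p, Λ^p R) ≠ 0` for some `i`. -/
noncomputable def ringCosupport (R : Type u) [CommRing R] : Set (PrimeSpectrum R) :=
  { p | ∃ i : ℕ, Nontrivial (((Ext R (ModuleCat.{u} R) i).obj
      (op (ModuleCat.of R (Localization.AtPrime p.asIdeal)))).obj
      (ModuleCat.of R (AdicCompletion p.asIdeal R))) }

section Homological

open Limits

variable {R : Type*} [Ring R] {C : Type*} [Category* C] [Abelian C] [Linear R C]
  [EnoughProjectives C]

/-- If `Ext⁰(X, Y) = 0`, then every map from the degree zero term of a projective resolution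
of `X` to `Y` which is a cocycle vanishes. -/
lemma CategoryTheory.ProjectiveResolution.eq_zero_of_subsingleton_ext {X Y : C}
    (P : ProjectiveResolution X)
    (h : Subsingleton (((Ext R C 0).obj (op X)).obj Y))
    (g : P.complex.X 0 ⟶ Y) (hg : P.complex.d 1 0 ≫ g = 0) : g = 0 := by
  have hz : (P.complex.linearYonedaObj R Y).ExactAt 0 :=
    ((P.complex.linearYonedaObj R Y).exactAt_iff_isZero_homology 0).2
      ((ModuleCat.isZero_of_subsingleton _).of_iso (P.isoExt 0 Y).symm)
  rw [HomologicalComplex.exactAt_iff' _ 0 0 1 (by simp) (by simp),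
    ShortComplex.moduleCat_exact_iff] at hz
  obtain ⟨y, hy⟩ := hz g hg
  have hy' : P.complex.d 0 0 ≫ (show P.complex.X 0 ⟶ Y from y) = g := hy
  rw [← hy', P.complex.shape 0 0 (by simp), zero_comp]

/-- If `Ext¹(X, Y) = 0`, then every `1`-cocycle on a projective resolution of `X` with values
in `Y` is a coboundary. -/
lemma CategoryTheory.ProjectiveResolution.exists_comp_eq_of_subsingleton_ext {X Y : C}
    (P : ProjectiveResolution X)
    (h : Subsingleton (((Ext R C 1).obj (op X)).obj Y))
    (g : P.complex.X 1 ⟶ Y) (hg : P.complex.d 2 1 ≫ g = 0) :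
    ∃ k : P.complex.X 0 ⟶ Y, P.complex.d 1 0 ≫ k = g := by
  have hz : (P.complex.linearYonedaObj R Y).ExactAt 1 :=
    ((P.complex.linearYonedaObj R Y).exactAt_iff_isZero_homology 1).2
      ((ModuleCat.isZero_of_subsingleton _).of_iso (P.isoExt 1 Y).symm)
  rw [HomologicalComplex.exactAt_iff' _ 0 1 2 (by simp) (by simp),
    ShortComplex.moduleCat_exact_iff] at hz
  exact hz g hg

/-- If `Ext⁰(X₃, Y)` and `Ext¹(X₃, Y)` vanish, a map `X₁ ⟶ Y` extends uniquely along the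
monomorphism of a short exact sequence `0 ⟶ X₁ ⟶ X₂ ⟶ X₃ ⟶ 0` with `X₁` and `X₂` projective. -/
lemma CategoryTheory.ShortComplex.ShortExact.existsUnique_comp_eq_of_subsingleton_ext
    {S : ShortComplex C} (hS : S.ShortExact) [Projective S.X₁] [Projective S.X₂] {Y : C}
    (h₀ : Subsingleton (((Ext R C 0).obj (Opposite.op S.X₃)).obj Y))
    (h₁ : Subsingleton (((Ext R C 1).obj (Opposite.op S.X₃)).obj Y))
    (f : S.X₁ ⟶ Y) : ∃! e : S.X₂ ⟶ Y, S.f ≫ e = f := by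
  have := hS.mono_f
  have := hS.epi_g
  let P := projectiveResolution S.X₃
  obtain ⟨π, hπ, hπe⟩ : ∃ π : P.complex.X 0 ⟶ S.X₃, ∃ w : P.complex.d 1 0 ≫ π = 0,
      Epi π ∧ (ShortComplex.mk _ _ w).Exact :=
    ⟨P.π.f 0, P.complex_d_comp_π_f_zero, inferInstanceAs (Epi (P.π.f 0)), P.exact₀⟩
  obtain ⟨hπepi, hπx⟩ := hπe
  refine existsUnique_of_exists_of_unique ?_ ?_
  · let φ : P.complex.X 0 ⟶ S.X₂ := Projective.factorThru π S.g
    have hφ : φ ≫ S.g = π := Projective.factorThru_comp _ _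
    let ψ : P.complex.X 1 ⟶ S.X₁ := hS.exact.lift (P.complex.d 1 0 ≫ φ) (by simp [hφ, hπ])
    have hψ : ψ ≫ S.f = P.complex.d 1 0 ≫ φ := hS.exact.lift_f _ _
    have hdψ : P.complex.d 2 1 ≫ ψ = 0 := by
      simp [← cancel_mono S.f, hψ]
    obtain ⟨g, hg⟩ := P.exists_comp_eq_of_subsingleton_ext h₁ (ψ ≫ f)
      (by rw [← Category.assoc, hdψ, zero_comp])
    let χ : S.X₂ ⟶ P.complex.X 0 := Projective.factorThru S.g π
    have hχ : χ ≫ π = S.g := Projective.factorThru_comp _ _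
    let θ : S.X₂ ⟶ S.X₁ := hS.exact.lift (𝟙 _ - χ ≫ φ) (by simp [hφ, hχ])
    have hθ : θ ≫ S.f = 𝟙 _ - χ ≫ φ := hS.exact.lift_f _ _
    let k : S.X₁ ⟶ P.complex.X 1 := hπx.liftFromProjective (S.f ≫ χ) (by simp [hχ])
    have hk : k ≫ P.complex.d 1 0 = S.f ≫ χ := hπx.liftFromProjective_comp _ _
    have hfθ : S.f ≫ θ = 𝟙 _ - k ≫ ψ := by
      rw [← cancel_mono S.f, Category.assoc, hθ, Preadditive.sub_comp, Category.assoc, hψ,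
        ← Category.assoc k, hk]
      simp
    refine ⟨θ ≫ f + χ ≫ g, ?_⟩
    rw [Preadditive.comp_add, ← Category.assoc, hfθ, ← Category.assoc, ← hk, Category.assoc, hg]
    simp
  · intro e₁ e₂ he₁ he₂
    have h0 : S.f ≫ (e₁ - e₂) = 0 := by simp [he₁, he₂]
    rw [← sub_eq_zero]
    have hd := hS.exact.g_desc (e₁ - e₂) h0
    have : π ≫ hS.exact.desc (e₁ - e₂) h0 = 0 :=
      P.eq_zero_of_subsingleton_ext h₀ _ (by rw [← Category.assoc, hπ, zero_comp])
    rw [← hd, zero_of_epi_comp π this, comp_zero]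

end Homological

section Tower

variable {R : Type*} [CommRing R] (s : ℕ → R)

/-- The map whose kernel and cokernel are `lim` and `lim¹` of the tower
`⋯ ⟶ M ⟶ M ⟶ M` with transition maps multiplication by `s n`. -/
def towerMap (M : Type*) [AddCommGroup M] [Module R M] : (ℕ → M) →ₗ[R] (ℕ → M) where
  toFun x n := x n - s n • x (n + 1)
  map_add' x y := by ext n; simp only [Pi.add_apply, smul_add]; abel
  map_smul' r x := by ext n; simp [smul_sub, smul_comm r]

@[simp]
lemma towerMap_apply {M : Type*} [AddCommGroup M] [Module R M] (x : ℕ → M) (n : ℕ) :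
    towerMap s M x n = x n - s n • x (n + 1) := rfl

variable {s}

lemma mem_smul_top_of_towerMap_mem {M : Type*} [AddCommGroup M] [Module R M]
    (hM : Function.Bijective (towerMap s M)) {I : Ideal R} (hI : I.FG) {x : ℕ → M}
    (hx : ∀ n, towerMap s M x n ∈ I • (⊤ : Submodule R M)) (n : ℕ) :
    x n ∈ I • (⊤ : Submodule R M) := by
  obtain ⟨k, a, rfl⟩ := Submodule.fg_iff_exists_fin_generating_family.1 hI
  have key (m : M) : m ∈ Submodule.span R (Set.range a) • (⊤ : Submodule R M) ↔
      ∃ c : Fin k → M, ∑ i, a i • c i = m := by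
    constructor
    · intro hm
      refine Submodule.smul_induction_on hm ?_ ?_
      · intro r hr m _
        obtain ⟨b, rfl⟩ := (Submodule.mem_span_range_iff_exists_fun R).1 hr
        exact ⟨fun i => b i • m, by
          simp [Finset.sum_smul, smul_smul, mul_comm]⟩
      · rintro _ _ ⟨c, rfl⟩ ⟨d, rfl⟩
        exact ⟨c + d, by simp [Finset.sum_add_distrib]⟩
    · rintro ⟨c, rfl⟩
      exact Submodule.sum_mem _ fun i _ =>
        Submodule.smul_mem_smul (Submodule.subset_span ⟨i, rfl⟩) trivial
  choose w hw using fun n => (key _).1 (hx n)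
  choose v hv using fun i => hM.2 (fun n => w n i)
  have : x = ∑ i, a i • v i := hM.1 <| by
    ext n
    rw [map_sum, ← hw n, Finset.sum_apply]
    simp only [map_smul, hv, Pi.smul_apply]
  exact (key _).2 ⟨fun i => v i n, by simp [this, Finset.sum_apply]⟩

lemma towerMap_bijective_of_ker_eq_smul_top {M N : Type*} [AddCommGroup M] [Module R M]
    [AddCommGroup N] [Module R N] (hM : Function.Bijective (towerMap s M))
    {I : Ideal R} (hI : I.FG) (f : M →ₗ[R] N) (hf : Function.Surjective f)
    (hker : LinearMap.ker f = I • ⊤) : Function.Bijective (towerMap s N) := by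
  constructor
  · rw [← LinearMap.ker_eq_bot, LinearMap.ker_eq_bot']
    intro y hy
    choose x hx using fun n => hf (y n)
    ext n
    rw [← hx n, Pi.zero_apply, ← LinearMap.mem_ker, hker]
    refine mem_smul_top_of_towerMap_mem hM hI (fun n => ?_) n
    rw [← hker, LinearMap.mem_ker]
    simpa [hx] using congrFun hy n
  · intro y
    choose x hx using fun n => hf (y n)
    obtain ⟨z, hz⟩ := hM.2 x
    refine ⟨fun n => f (z n), funext fun n => ?_⟩
    rw [← hx n, ← hz]
    simp

lemma not_towerMap_injective_of_isUnit {D : Type*} [CommRing D] [Nontrivial D] [Algebra R D]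
    (hs : ∀ n, IsUnit (algebraMap R D (s n))) : ¬ Function.Injective (towerMap s D) := by
  intro h
  choose v hv using fun n => (hs n).exists_right_inv
  have : (fun n => ∏ k ∈ Finset.range n, v k) = (0 : ℕ → D) := h <| by
    ext n
    simp only [towerMap_apply, Algebra.smul_def, Finset.prod_range_succ, Pi.zero_apply]
    linear_combination (-∏ k ∈ Finset.range n, v k) * hv n
  simpa using congrFun this 0

lemma not_towerMap_surjective_of_not_isUnit {D : Type*} [CommRing D] [IsDomain D] [Countable D]
    [Algebra R D] (hs₀ : ∀ n, algebraMap R D (s n) ≠ 0)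
    (hs : ∀ n, ¬ IsUnit (algebraMap R D (s n))) : ¬ Function.Surjective (towerMap s D) := by
  classical
  intro h
  choose x hx using fun A : Set ℕ => h (A.indicator 1)
  obtain ⟨e, he⟩ := exists_injective_nat D
  refine Function.cantor_injective (fun A : Set ℕ => e (x A 0)) (he.comp fun A B hAB => ?_)
  have hstep (n : ℕ) (hn : x A n = x B n) : (n ∈ A ↔ n ∈ B) ∧ x A (n + 1) = x B (n + 1) := by
    have hA := congrFun (hx A) n
    have hB := congrFun (hx B) n
    simp only [towerMap_apply, Algebra.smul_def, Set.indicator_apply, Pi.one_apply] at hA hB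
    have hiff : n ∈ A ↔ n ∈ B := by
      by_contra hne
      refine hs n (isUnit_iff_dvd_one.2 ?_)
      by_cases hnA : n ∈ A <;> by_cases hnB : n ∈ B <;> simp only [hnA, hnB, if_true, if_false,
        not_true_eq_false, iff_true, iff_false, not_false_eq_true] at hA hB hne
      · exact ⟨x B (n + 1) - x A (n + 1), by linear_combination hB - hA + hn⟩
      · exact ⟨x A (n + 1) - x B (n + 1), by linear_combination hA - hB - hn⟩
    refine ⟨hiff, mul_left_cancel₀ (hs₀ n) ?_⟩
    simp only [hiff] at hA
    linear_combination hB - hA + hn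
  have hall (n : ℕ) : x A n = x B n := by
    induction n with
    | zero => exact hAB
    | succ n ih => exact (hstep n ih).2
  exact Set.ext fun n => (hstep n (hall n)).1

end Tower

section Telescope

variable {R : Type*} [CommRing R] (s : ℕ → R)

/-- The endomorphism of the free module on `ℕ` sending the `n`-th basis vector `e n` to
`e n - s n • e (n + 1)`. -/
noncomputable def telescopeMap : (ℕ →₀ R) →ₗ[R] (ℕ →₀ R) :=
  Finsupp.linearCombination R fun n => Finsupp.single n 1 - Finsupp.single (n + 1) (s n)

@[simp]
lemma telescopeMap_single (n : ℕ) (r : R) : telescopeMap s (Finsupp.single n r) =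
    Finsupp.single n r - Finsupp.single (n + 1) (r * s n) := by
  simp [telescopeMap, smul_sub]

lemma telescopeMap_apply_zero (a : ℕ →₀ R) : telescopeMap s a 0 = a 0 := by
  induction a using Finsupp.induction_linear with
  | zero => simp
  | add f g hf hg => simp [hf, hg]
  | single n r => simp

lemma telescopeMap_apply_succ (a : ℕ →₀ R) (n : ℕ) :
    telescopeMap s a (n + 1) = a (n + 1) - a n * s n := by
  induction a using Finsupp.induction_linear with
  | zero => simp
  | add f g hf hg => simp only [map_add, Finsupp.add_apply, hf, hg]; ring
  | single m r =>
    by_cases h : m = n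
    · subst h; simp
    · simp [Finsupp.single_apply, h]

lemma telescopeMap_injective : Function.Injective (telescopeMap s) := by
  rw [← LinearMap.ker_eq_bot, LinearMap.ker_eq_bot']
  intro a ha
  ext n
  induction n with
  | zero => rw [← telescopeMap_apply_zero s, ha]
  | succ n ih =>
    have := telescopeMap_apply_succ s a n
    rw [ha, ih] at this
    simpa using this.symm

lemma single_sub_single_mem_range_telescopeMap (n k : ℕ) (r : R) :
    Finsupp.single n r - Finsupp.single (n + k) (r * ∏ i ∈ Finset.range k, s (n + i)) ∈
      LinearMap.range (telescopeMap s) := by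
  induction k with
  | zero => simp
  | succ k ih =>
    rw [← sub_add_sub_cancel _ (Finsupp.single (n + k) (r * ∏ i ∈ Finset.range k, s (n + i)))]
    refine add_mem ih ⟨Finsupp.single (n + k) (r * ∏ i ∈ Finset.range k, s (n + i)), ?_⟩
    rw [telescopeMap_single, Finset.prod_range_succ, mul_assoc, add_assoc]

lemma exists_sub_single_mem_range_telescopeMap (a : ℕ →₀ R) :
    ∃ n r, a - Finsupp.single n r ∈ LinearMap.range (telescopeMap s) := by
  induction a using Finsupp.induction_linear with
  | zero => exact ⟨0, 0, by simp⟩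
  | single n r => exact ⟨n, r, by simp⟩
  | add f g hf hg =>
    obtain ⟨n, r, hf⟩ := hf
    obtain ⟨m, t, hg⟩ := hg
    have h₁ := add_mem hf (single_sub_single_mem_range_telescopeMap s n m r)
    have h₂ := add_mem hg (single_sub_single_mem_range_telescopeMap s m n t)
    rw [sub_add_sub_cancel] at h₁ h₂
    rw [add_comm m n] at h₂
    have h := add_mem h₁ h₂
    rw [← add_sub_add_comm, ← Finsupp.single_add] at h
    exact ⟨n + m, _, h⟩

lemma towerMap_bijective_of_existsUnique {M : Type*} [AddCommGroup M] [Module R M]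
    (h : ∀ f : (ℕ →₀ R) →ₗ[R] M, ∃! e : (ℕ →₀ R) →ₗ[R] M, e ∘ₗ telescopeMap s = f) :
    Function.Bijective (towerMap s M) := by
  have key (x y : ℕ → M) : towerMap s M x = y ↔ Finsupp.linearCombination R x ∘ₗ telescopeMap s =
      Finsupp.linearCombination R y := by
    constructor
    · rintro rfl
      ext n
      simp
    · intro hxy
      ext n
      simpa using LinearMap.congr_fun hxy (Finsupp.single n 1)
  rw [Function.bijective_iff_existsUnique]
  intro y
  obtain ⟨e, he, hu⟩ := h (Finsupp.linearCombination R y)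
  have he' : Finsupp.linearCombination R (fun n => e (Finsupp.single n 1)) = e := by
    ext n
    simp
  refine ⟨fun n => e (Finsupp.single n 1), (key _ _).2 (by rw [he']; exact he), fun x hx => ?_⟩
  ext n
  rw [← hu _ ((key _ _).1 hx)]
  simp

end Telescope

section Localization

variable {R : Type*} [CommRing R] {S : Submonoid R} (s : ℕ → S) (A : Type*) [CommRing A]
  [Algebra R A] [IsLocalization S A]

/-- The map from the free module on `ℕ` to a localization sending the `n`-th basis vector
to `1 / (s 0 * ⋯ * s (n - 1))`. -/
noncomputable def telescopeToLocalization : (ℕ →₀ R) →ₗ[R] A :=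
  Finsupp.linearCombination R fun n => IsLocalization.mk' A 1 (∏ i ∈ Finset.range n, s i)

@[simp]
lemma telescopeToLocalization_single (n : ℕ) (r : R) :
    telescopeToLocalization s A (Finsupp.single n r) =
      IsLocalization.mk' A r (∏ i ∈ Finset.range n, s i) := by
  rw [telescopeToLocalization, Finsupp.linearCombination_single, IsLocalization.smul_mk', mul_one]

lemma telescopeToLocalization_comp_telescopeMap :
    telescopeToLocalization s A ∘ₗ telescopeMap (fun n => (s n : R)) = 0 := by
  ext n
  simp only [LinearMap.comp_apply, Finsupp.lsingle_apply, telescopeMap_single, map_sub,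
    telescopeToLocalization_single, Finset.prod_range_succ, IsLocalization.mk'_cancel, sub_self,
    LinearMap.zero_apply]

variable {s}

lemma telescopeToLocalization_surjective (hs : ∀ (c : S) (n : ℕ), ∃ k, (c : R) ∣ s (n + k)) :
    Function.Surjective (telescopeToLocalization s A) := by
  intro z
  obtain ⟨r, c, rfl⟩ := IsLocalization.exists_mk'_eq S z
  obtain ⟨k, d, hd⟩ := hs c 0
  rw [zero_add] at hd
  refine ⟨Finsupp.single (k + 1) (r * d * (∏ i ∈ Finset.range k, s i : S)), ?_⟩
  rw [telescopeToLocalization_single]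
  refine IsLocalization.mk'_eq_of_eq ?_
  rw [Finset.prod_range_succ, Submonoid.coe_mul, hd]
  ring

lemma exact_telescopeMap_telescopeToLocalization
    (hs : ∀ (c : S) (n : ℕ), ∃ k, (c : R) ∣ s (n + k)) :
    Function.Exact (telescopeMap fun n => (s n : R)) (telescopeToLocalization s A) := by
  rw [LinearMap.exact_iff]
  have hle : LinearMap.range (telescopeMap fun n => (s n : R)) ≤
      LinearMap.ker (telescopeToLocalization s A) :=
    LinearMap.range_le_ker_iff.2 (telescopeToLocalization_comp_telescopeMap s A)
  refine le_antisymm (fun a ha => ?_) hle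
  obtain ⟨n, r, hr⟩ := exists_sub_single_mem_range_telescopeMap (fun n => (s n : R)) a
  have hr₀ := (Submodule.sub_mem_iff_right _ ha).1 (hle hr)
  rw [LinearMap.mem_ker, telescopeToLocalization_single, IsLocalization.mk'_eq_zero_iff] at hr₀
  obtain ⟨c, hc⟩ := hr₀
  obtain ⟨k, d, hd⟩ := hs c n
  have h := single_sub_single_mem_range_telescopeMap (fun n => (s n : R)) n (k + 1) r
  have hz : r * ∏ i ∈ Finset.range (k + 1), (s (n + i) : R) = 0 := by
    rw [Finset.prod_range_succ, hd]
    linear_combination (d * ∏ i ∈ Finset.range k, (s (n + i) : R)) * hc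
  rw [hz, Finsupp.single_zero, sub_zero] at h
  simpa using add_mem hr h

end Localization

lemma towerMap_bijective_of_subsingleton_ext {R : Type u} [CommRing R] {S : Submonoid R}
    {s : ℕ → S} (hs : ∀ (c : S) (n : ℕ), ∃ k, (c : R) ∣ s (n + k))
    (A : Type u) [CommRing A] [Algebra R A] [IsLocalization S A]
    (M : Type u) [AddCommGroup M] [Module R M]
    (h : ∀ i, Subsingleton (((Ext R (ModuleCat.{u} R) i).obj (op (ModuleCat.of R A))).obj
      (ModuleCat.of R M))) :
    Function.Bijective (towerMap (fun n => (s n : R)) M) := by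
  let T : ShortComplex (ModuleCat.{u} R) :=
    ShortComplex.mk (ModuleCat.ofHom (telescopeMap fun n => (s n : R)))
      (ModuleCat.ofHom (telescopeToLocalization s A)) (by
        rw [← ModuleCat.ofHom_comp, telescopeToLocalization_comp_telescopeMap]
        rfl)
  have hT : T.ShortExact :=
    { exact := (ShortComplex.ShortExact.moduleCat_exact_iff_function_exact T).2
        (exact_telescopeMap_telescopeToLocalization A hs)
      mono_f := (ModuleCat.mono_iff_injective _).2 (telescopeMap_injective _)
      epi_g := (ModuleCat.epi_iff_surjective _).2 (telescopeToLocalization_surjective A hs) }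
  have hP : Projective (ModuleCat.of R (ℕ →₀ R)) :=
    (IsProjective.iff_projective _).1 inferInstance
  have : Projective T.X₁ := hP
  have : Projective T.X₂ := hP
  refine towerMap_bijective_of_existsUnique _ fun f => ?_
  obtain ⟨e, he, hu⟩ := hT.existsUnique_comp_eq_of_subsingleton_ext (R := R)
    (Y := ModuleCat.of R M) (h 0) (h 1) (ModuleCat.ofHom f)
  refine ⟨e.hom, ?_, fun g hg => ?_⟩
  · exact congrArg ModuleCat.Hom.hom he
  · rw [← hu (ModuleCat.ofHom g) (by rw [← hg]; rfl)]
    rfl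

lemma towerMap_quotient_bijective {R : Type*} [CommRing R] {s : ℕ → R} {I : Ideal R} (hI : I.FG)
    (h : Function.Bijective (towerMap s (AdicCompletion I R))) :
    Function.Bijective (towerMap s (R ⧸ I)) := by
  let e : (R ⧸ (I ^ 1 • ⊤ : Submodule R R)) ≃ₗ[R] R ⧸ I :=
    Submodule.quotEquivOfEq _ _ (by simp)
  refine towerMap_bijective_of_ker_eq_smul_top h hI (e.toLinearMap ∘ₗ AdicCompletion.eval I R 1)
    (e.surjective.comp (AdicCompletion.eval_surjective I R 1)) ?_
  rw [LinearMap.ker_comp_of_ker_eq_bot _ e.ker, ← AdicCompletion.pow_smul_top_eq_ker_eval hI,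
    pow_one]


theorem countable_noetherian_full_cosupport (R : Type u) [CommRing R]
    [IsNoetherianRing R] [Countable R] :
    ∀ p : PrimeSpectrum R, p ∈ ringCosupport R := by
  intro p
  by_contra hp
  simp only [ringCosupport, Set.mem_ofPred_eq, not_exists, not_nontrivial_iff_subsingleton] at hp
  obtain ⟨e, he⟩ := exists_surjective_nat p.asIdeal.primeCompl
  have hbij (a : p.asIdeal.primeCompl) : Function.Bijective
      (towerMap (fun n => ((a * e n.unpair.2 : p.asIdeal.primeCompl) : R)) (R ⧸ p.asIdeal)) := by
    refine towerMap_quotient_bijective p.asIdeal.fg_of_isNoetherianRing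
      (towerMap_bijective_of_subsingleton_ext (fun c n => ?_)
        (Localization.AtPrime p.asIdeal) _ hp)
    obtain ⟨j, rfl⟩ := he c
    obtain ⟨k, hk⟩ := Nat.exists_eq_add_of_le (Nat.left_le_pair n j)
    refine ⟨k, a, ?_⟩
    rw [← hk, Nat.unpair_pair, Submonoid.coe_mul, mul_comm]
  by_cases hu : ∀ c : p.asIdeal.primeCompl, IsUnit (algebraMap R (R ⧸ p.asIdeal) c)
  · exact not_towerMap_injective_of_isUnit (fun n => hu _) (hbij 1).1
  · push Not at hu
    obtain ⟨a, ha⟩ := hu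
    have : Countable (R ⧸ p.asIdeal) := Ideal.Quotient.mk_surjective.countable
    refine not_towerMap_surjective_of_not_isUnit (fun n => ?_) (fun n h => ha ?_) (hbij a).2
    · exact fun h => (a * e n.unpair.2).2 (Ideal.Quotient.eq_zero_iff_mem.1 h)
    · rw [Submonoid.coe_mul, map_mul] at h
      exact isUnit_of_mul_isUnit_left h
end

section
/- Let R be a commutative noetherian integral domain of Krull dimension 1 that is not a complete local ring (i.e., it is not the case that R is local and complete with respect to the adic topology of its maximal ideal). Then R has full cosupport; that is, for every prime ideal p of R there exists i ≥ 0 such that Ext^i_R(R_p, Λ^p R) ≠ 0. -/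
open CategoryTheory Opposite

universe u

theorem exists_lift_of_isZero_ext_one {R : Type*} [Ring R] {C : Type*} [Category* C] [Abelian C]
    [Linear R C] [EnoughProjectives C] {S : ShortComplex C} (hS : S.ShortExact) {X : C}
    (h : Limits.IsZero (((Ext R C 1).obj (op X)).obj S.X₁)) (f : X ⟶ S.X₃) :
    ∃ g : X ⟶ S.X₂, g ≫ S.g = f := by
  let P := projectiveResolution X
  have hm := hS.mono_f
  have he := hS.epi_g
  have hex : (P.complex.linearYonedaObj R S.X₁).ExactAt 1 :=
    (HomologicalComplex.exactAt_iff_isZero_homology _ _).2 (h.of_iso (P.isoExt 1 S.X₁).symm)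
  rw [HomologicalComplex.exactAt_iff' _ 0 1 2 (by simp) (by simp),
    ShortComplex.moduleCat_exact_iff] at hex
  let π : P.complex.X 0 ⟶ X := P.π.f 0
  have hπ : P.complex.d 1 0 ≫ π = 0 := P.complex_d_comp_π_f_zero
  let l : P.complex.X 0 ⟶ S.X₂ := Projective.factorThru (π ≫ f) S.g
  have hl : l ≫ S.g = π ≫ f := Projective.factorThru_comp _ _
  let φ : P.complex.X 1 ⟶ S.X₁ := hS.exact.lift (P.complex.d 1 0 ≫ l) (by simp [hl, reassoc_of% hπ])
  have hφ : φ ≫ S.f = P.complex.d 1 0 ≫ l := hS.exact.lift_f _ _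
  obtain ⟨ψ, hψ⟩ := hex φ (by
    change P.complex.d 2 1 ≫ φ = 0
    simp [← cancel_mono S.f, hφ])
  change P.complex.X 0 ⟶ S.X₁ at ψ
  change P.complex.d 1 0 ≫ ψ = φ at hψ
  obtain ⟨g, hg⟩ : ∃ g : X ⟶ S.X₂, π ≫ g = l - ψ ≫ S.f :=
    ⟨_, P.isColimitCokernelCofork.fac (Limits.CokernelCofork.ofπ (l - ψ ≫ S.f)
      (by simp [← hφ, ← hψ])) Limits.WalkingParallelPair.one⟩
  have : Epi π := inferInstanceAs (Epi (P.π.f 0))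
  exact ⟨g, by simp [← cancel_epi π, reassoc_of% hg, hl]⟩

theorem eq_zero_of_isZero_ext_zero {R : Type*} [Ring R] {C : Type*} [Category* C] [Abelian C]
    [Linear R C] [EnoughProjectives C] {X Y : C}
    (h : Limits.IsZero (((Ext R C 0).obj (op X)).obj Y)) (f : X ⟶ Y) : f = 0 := by
  let P := projectiveResolution X
  have hex : (P.complex.linearYonedaObj R Y).ExactAt 0 :=
    (HomologicalComplex.exactAt_iff_isZero_homology _ _).2 (h.of_iso (P.isoExt 0 Y).symm)
  rw [HomologicalComplex.exactAt_iff' _ 0 0 1 (by simp) (by simp),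
    ShortComplex.moduleCat_exact_iff] at hex
  let π : P.complex.X 0 ⟶ X := P.π.f 0
  have hπ : P.complex.d 1 0 ≫ π = 0 := P.complex_d_comp_π_f_zero
  obtain ⟨ψ, hψ⟩ := hex (π ≫ f) (by
    change P.complex.d 1 0 ≫ π ≫ f = 0
    simp [reassoc_of% hπ])
  change P.complex.X 0 ⟶ Y at ψ
  change P.complex.d 0 0 ≫ ψ = π ≫ f at hψ
  have : Epi π := inferInstanceAs (Epi (P.π.f 0))
  rw [← cancel_epi π, ← hψ, P.complex.shape 0 0 (by simp)]
  simp

theorem exists_forall_dvd_sub_of_lift {R K : Type*} [CommRing R] [IsDomain R] [Field K] [Algebra R K]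
    [IsFractionRing R K]
    (hlift : ∀ f : K →ₗ[R] K ⧸ LinearMap.range (Algebra.linearMap R K),
      ∃ g : K →ₗ[R] K, Submodule.mkQ _ ∘ₗ g = f)
    (z : R → R) (hz : ∀ b c, b ≠ 0 → c ≠ 0 → b ∣ z (b * c) - z b) :
    ∃ q, ∀ b, b ≠ 0 → b ∣ q - z b := by
  let N := LinearMap.range (Algebra.linearMap R K)
  have hden (t : K) : ∃ b : R, b ≠ 0 ∧ b • t ∈ N := by
    obtain ⟨a, b, hb, rfl⟩ := IsFractionRing.div_surjective (A := R) t
    have hb0 := nonZeroDivisors.ne_zero hb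
    have : algebraMap R K b ≠ 0 := by simpa using hb0
    exact ⟨b, hb0, a, by rw [Algebra.smul_def]; field_simp; rfl⟩
  choose d hd0 hd using hden
  have hmul {b c : R} {t : K} (hb : b ≠ 0) (hc : c ≠ 0) (ht : b • t ∈ N) :
      N.mkQ (z (b * c) • t) = N.mkQ (z b • t) := by
    obtain ⟨r, hr⟩ := hz b c hb hc
    rw [← sub_eq_zero, ← map_sub, ← sub_smul, hr, mul_comm, mul_smul,
      Submodule.mkQ_apply, Submodule.Quotient.mk_eq_zero]
    exact N.smul_mem r ht
  have hind {b : R} {t : K} (hb : b ≠ 0) (ht : b • t ∈ N) :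
      N.mkQ (z (d t) • t) = N.mkQ (z b • t) := by
    rw [← hmul (hd0 t) hb (hd t), mul_comm, hmul hb (hd0 t) ht]
  let f : K →ₗ[R] K ⧸ N :=
    { toFun t := N.mkQ (z (d t) • t)
      map_add' t u := by
        have h0 := mul_ne_zero (hd0 t) (hd0 u)
        have ht : (d t * d u) • t ∈ N := by
          rw [mul_comm, mul_smul]; exact N.smul_mem _ (hd t)
        have hu : (d t * d u) • u ∈ N := by
          rw [mul_smul]; exact N.smul_mem _ (hd u)
        rw [hind h0 ht, hind h0 hu, hind h0 (smul_add (d t * d u) t u ▸ N.add_mem ht hu),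
          smul_add, map_add]
      map_smul' r t := by
        rw [hind (hd0 t) (t := r • t) (smul_comm (d t) r t ▸ N.smul_mem r (hd t)), smul_comm,
          map_smul, RingHom.id_apply] }
  obtain ⟨g, hg⟩ := hlift f
  have key (b : R) (hb : b ≠ 0) : ∃ r : R, b • g (algebraMap R K b)⁻¹ =
      algebraMap R K (z b + b * r) := by
    have hb' : algebraMap R K b ≠ 0 := by simpa using hb
    have h1 : N.mkQ (g (algebraMap R K b)⁻¹) = N.mkQ (z b • (algebraMap R K b)⁻¹) :=
      (LinearMap.congr_fun hg _).trans (hind hb ⟨1, by simp [Algebra.smul_def, hb']⟩)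
    rw [← sub_eq_zero, ← map_sub, Submodule.mkQ_apply, Submodule.Quotient.mk_eq_zero] at h1
    obtain ⟨r, hr⟩ := h1
    refine ⟨r, ?_⟩
    rw [sub_eq_iff_eq_add.1 hr.symm]
    simp only [Algebra.linearMap_apply, Algebra.smul_def, map_add, map_mul]
    field_simp
    ring
  have hone (b : R) (hb : b ≠ 0) : b • g (algebraMap R K b)⁻¹ = g 1 := by
    have hb' : algebraMap R K b ≠ 0 := by simpa using hb
    rw [← map_smul, Algebra.smul_def, mul_inv_cancel₀ hb']
  obtain ⟨r₁, h₁⟩ := key 1 one_ne_zero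
  refine ⟨z 1 + 1 * r₁, fun b hb => ?_⟩
  obtain ⟨r, hr⟩ := key b hb
  rw [hone b hb, ← hone 1 one_ne_zero, h₁] at hr
  exact ⟨r, by rw [IsFractionRing.injective R K hr]; ring⟩

theorem exists_notMem_pow_mul_dvd {R : Type*} [CommRing R] [IsDomain R] [IsNoetherianRing R]
    [Ring.KrullDimLE 1 R] (m : Ideal R) [m.IsMaximal] {b : R} (hb : b ≠ 0) :
    ∃ s ∉ m, ∃ k : ℕ, ∀ x ∈ m ^ k, b ∣ s * x := by
  have hpt : ∀ x ∈ m, ∃ s ∉ m, ∃ n : ℕ, b ∣ s * x ^ n := by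
    intro x hx
    by_contra! H
    obtain ⟨p, hp, hbp, hdisj⟩ := Ideal.exists_le_prime_disjoint (Ideal.span {b})
      (m.primeCompl ⊔ Submonoid.powers x) (by
        rw [Set.disjoint_right]
        intro y hy hyb
        obtain ⟨s, hs, _, ⟨n, rfl⟩, rfl⟩ := Submonoid.mem_sup.1 hy
        exact H s hs n (Ideal.mem_span_singleton.1 hyb))
    rw [Set.disjoint_left] at hdisj
    have hpm : p ≤ m := fun y hy => by
      by_contra hym
      exact hdisj hy (Submonoid.mem_sup_left hym)
    have hp0 : p ≠ ⊥ := fun h => hb (by simpa [h] using hbp (Ideal.mem_span_singleton_self b))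
    have hmax := hp.isMaximal_of_ne_bot hp0
    rw [← hmax.eq_of_le Ideal.IsPrime.ne_top' hpm] at hx
    exact hdisj hx (Submonoid.mem_sup_right (Submonoid.mem_powers x))
  let J : Ideal R :=
    { carrier := {x | ∃ s ∉ m, b ∣ s * x}
      zero_mem' := ⟨1, m.one_notMem, by simp⟩
      add_mem' := by
        rintro x y ⟨s, hs, hx⟩ ⟨t, ht, hy⟩
        refine ⟨s * t, m.primeCompl.mul_mem hs ht, ?_⟩
        rw [show s * t * (x + y) = t * (s * x) + s * (t * y) by ring]
        exact dvd_add (hx.mul_left _) (hy.mul_left _)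
      smul_mem' := by
        rintro c x ⟨s, hs, hx⟩
        exact ⟨s, hs, by rw [smul_eq_mul, mul_left_comm]; exact hx.mul_left _⟩ }
  have hJ : m ≤ J.radical := fun x hx => by
    obtain ⟨s, hs, n, h⟩ := hpt x hx
    exact ⟨n, s, hs, h⟩
  obtain ⟨k, hk⟩ := Ideal.exists_pow_le_of_le_radical_of_fg hJ m.fg_of_isNoetherianRing
  have hcommon (I : Ideal R) : I.FG → I ≤ J → ∃ s ∉ m, ∀ x ∈ I, b ∣ s * x := by
    intro hI
    induction I, hI using Submodule.fg_induction with
    | singleton x =>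
      intro hx
      obtain ⟨s, hs, h⟩ := hx (Submodule.mem_span_singleton_self x)
      refine ⟨s, hs, fun y hy => ?_⟩
      obtain ⟨c, rfl⟩ := Submodule.mem_span_singleton.1 hy
      rw [smul_eq_mul, mul_left_comm]
      exact h.mul_left _
    | sup I₁ I₂ _ _ h₁ h₂ =>
      intro h
      obtain ⟨s, hs, h₁⟩ := h₁ (le_sup_left.trans h)
      obtain ⟨t, ht, h₂⟩ := h₂ (le_sup_right.trans h)
      refine ⟨s * t, m.primeCompl.mul_mem hs ht, fun x hx => ?_⟩
      obtain ⟨y, hy, w, hw, rfl⟩ := Submodule.mem_sup.1 hx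
      rw [show s * t * (y + w) = t * (s * y) + s * (t * w) by ring]
      exact dvd_add ((h₁ y hy).mul_left _) ((h₂ w hw).mul_left _)
  obtain ⟨s, hs, h⟩ := hcommon (m ^ k) (m ^ k).fg_of_isNoetherianRing hk
  exact ⟨s, hs, k, h⟩

theorem dvd_of_pow_mul_dvd_of_notMem {R : Type*} [CommRing R] {m : Ideal R} [m.IsMaximal]
    {b s y : R} {k : ℕ} (hk : ∀ x ∈ m ^ k, b ∣ y * x) (hs : s ∉ m) (h : b ∣ s * y) : b ∣ y := by
  obtain ⟨c, i, hi, hci⟩ := Ideal.IsMaximal.exists_inv_pow m hs k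
  rw [show y = c * (s * y) + y * i by linear_combination -y * hci]
  exact dvd_add (h.mul_left _) (hk i hi)

theorem isLocalRing_of_forall_exists_dvd_sub {R : Type*} [CommRing R] [IsDomain R]
    [IsNoetherianRing R] [Ring.KrullDimLE 1 R] (hf : ¬ IsField R)
    (hR : ∀ z : R → R, (∀ b c, b ≠ 0 → c ≠ 0 → b ∣ z (b * c) - z b) →
      ∃ q, ∀ b, b ≠ 0 → b ∣ q - z b) : IsLocalRing R := by
  obtain ⟨m, hm⟩ := Ideal.exists_maximal R
  refine IsLocalRing.of_unique_max_ideal ⟨m, hm, fun n hn => ?_⟩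
  have hex (b : R) (hb : b ≠ 0) :
      ∃ z, (∃ k : ℕ, ∀ x ∈ m ^ k, b ∣ z * x) ∧ ∃ s ∉ m, b ∣ s * (z - 1) := by
    obtain ⟨s, hs, k, h⟩ := exists_notMem_pow_mul_dvd m hb
    obtain ⟨c, i, hi, hci⟩ := Ideal.IsMaximal.exists_inv_pow m hs k
    refine ⟨c * s, ⟨k, fun x hx => ?_⟩, s, hs, ?_⟩
    · rw [mul_assoc]
      exact (h x hx).mul_left c
    · rw [show s * (c * s - 1) = -(s * i) by linear_combination s * hci]
      exact (h i hi).neg_right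
  choose! z hz₀ hz₁ using hex
  obtain ⟨q, hq⟩ := hR z fun b c hb hc => by
    obtain ⟨k, hk⟩ := hz₀ _ (mul_ne_zero hb hc)
    obtain ⟨s, hs, hs'⟩ := hz₁ _ (mul_ne_zero hb hc)
    obtain ⟨l, hl⟩ := hz₀ _ hb
    obtain ⟨t, ht, ht'⟩ := hz₁ _ hb
    have hbc {y : R} (h : b * c ∣ y) : b ∣ y := (Dvd.intro c rfl).trans h
    refine dvd_of_pow_mul_dvd_of_notMem (k := k + l) (s := s * t) (fun x hx => ?_)
      (m.primeCompl.mul_mem hs ht) ?_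
    · rw [sub_mul]
      exact dvd_sub (hbc (hk x (Ideal.pow_le_pow_right le_self_add hx)))
        (hl x (Ideal.pow_le_pow_right le_add_self hx))
    · rw [show s * t * (z (b * c) - z b) = t * (s * (z (b * c) - 1)) - s * (t * (z b - 1)) by ring]
      exact dvd_sub ((hbc hs').mul_left _) (ht'.mul_left _)
  have hidem (b : R) (hb : b ≠ 0) : b ∣ q * (q - 1) := by
    obtain ⟨k, hk⟩ := hz₀ _ hb
    obtain ⟨s, hs, hs'⟩ := hz₁ _ hb
    have h : b ∣ z b * (z b - 1) := by
      refine dvd_of_pow_mul_dvd_of_notMem (k := k) (fun x hx => ?_) hs ?_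
      · rw [mul_right_comm]
        exact (hk x hx).mul_right _
      · rw [mul_left_comm]
        exact hs'.mul_left _
    rw [show q * (q - 1) = z b * (z b - 1) + (q - z b) * (q + z b - 1) by ring]
    exact dvd_add h ((hq b hb).mul_right _)
  have hne (I : Ideal R) (hI : I.IsMaximal) : ∃ b ∈ I, b ≠ 0 :=
    Submodule.exists_mem_ne_zero_of_ne_bot (Ring.ne_bot_of_isMaximal_of_not_isField hI hf)
  obtain ⟨b, hbm, hb⟩ := hne m hm
  have hq0 : q * (q - 1) = 0 := by
    by_contra h
    have hdvd : q * (q - 1) * b ∣ q * (q - 1) * 1 := by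
      simpa using hidem _ (mul_ne_zero h hb)
    exact hm.ne_top (m.eq_top_of_isUnit_mem hbm
      (isUnit_of_dvd_one ((mul_dvd_mul_iff_left h).1 hdvd)))
  rcases mul_eq_zero.1 hq0 with rfl | hq1
  · obtain ⟨s, hs, hs'⟩ := hz₁ _ hb
    refine absurd (m.mem_of_dvd ?_ hbm) hs
    rw [show s = -(s * (0 - z b)) - s * (z b - 1) by ring]
    exact dvd_sub ((hq b hb).mul_left s).neg_right hs'
  · obtain ⟨b, hbn, hb⟩ := hne n hn
    obtain ⟨k, hk⟩ := hz₀ _ hb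
    have hle : m ^ k ≤ n := fun x hx => n.mem_of_dvd (by
      rw [show x = (q - z b) * x + z b * x by linear_combination -x * hq1]
      exact dvd_add ((hq b hb).mul_right x) (hk x hx)) hbn
    exact (hm.eq_of_le hn.ne_top (hn.isPrime.le_of_pow_le hle)).symm

theorem isPrecomplete_maximalIdeal_of_forall_exists_dvd_sub {R : Type*} [CommRing R] [IsDomain R]
    [IsNoetherianRing R] [Ring.KrullDimLE 1 R] [IsLocalRing R] (hf : ¬ IsField R)
    (hR : ∀ z : R → R, (∀ b c, b ≠ 0 → c ≠ 0 → b ∣ z (b * c) - z b) →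
      ∃ q, ∀ b, b ≠ 0 → b ∣ q - z b) : IsPrecomplete (IsLocalRing.maximalIdeal R) R := by
  set m := IsLocalRing.maximalIdeal R with hm
  refine ⟨fun f hcauchy => ?_⟩
  simp only [SModEq.sub_mem, smul_eq_mul, Ideal.mul_top] at hcauchy ⊢
  have hex (b : R) (hb : b ≠ 0) : ∃ k : ℕ, ∀ x ∈ m ^ k, b ∣ x := by
    obtain ⟨s, hs, k, h⟩ := exists_notMem_pow_mul_dvd m hb
    have hs : IsUnit s := by simpa [hm] using hs
    exact ⟨k, fun x hx => hs.dvd_mul_left.1 (h x hx)⟩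
  choose! k hk using hex
  have hf' {b : R} (hb : b ≠ 0) {n : ℕ} (hn : k b ≤ n) : b ∣ f (k b) - f n :=
    hk b hb _ (hcauchy hn)
  obtain ⟨q, hq⟩ := hR (fun b => f (k b)) fun b c hb hc => by
    have h₁ := hf' hb (le_max_left (k b) (k (b * c)))
    have h₂ := hf' (mul_ne_zero hb hc) (le_max_right (k b) (k (b * c)))
    have := dvd_sub ((Dvd.intro c rfl).trans h₂) h₁
    simpa using this
  obtain ⟨x, hxm, hx⟩ := Submodule.exists_mem_ne_zero_of_ne_bot
    (IsLocalRing.isField_iff_maximalIdeal_eq.not.1 hf)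
  refine ⟨q, fun n => ?_⟩
  have hxn : x ^ n ≠ 0 := pow_ne_zero n hx
  have h₁ := hf' hxn (le_max_left (k (x ^ n)) n)
  have h₂ := (m ^ n).mem_of_dvd (dvd_add (hq _ hxn) h₁) (Ideal.pow_mem_pow hxm n)
  have h₃ := (m ^ n).sub_mem (hcauchy (le_max_right (k (x ^ n)) n)) h₂
  simpa using h₃

theorem AdicCompletion.isUnit_algebraMap_of_notMem {R : Type*} [CommRing R] {m : Ideal R}
    [m.IsMaximal] (hm : m.FG) {s : R} (hs : s ∉ m) :
    IsUnit (algebraMap R (AdicCompletion m R) s) := by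
  have := AdicCompletion.isMaximal_map_of_le m m le_rfl hm
  have := AdicCompletion.isAdicComplete_self m hm
  have := isLocalRing_of_isAdicComplete_maximal (m.map (algebraMap R (AdicCompletion m R)))
  rw [← IsLocalRing.notMem_maximalIdeal, ← IsLocalRing.eq_maximalIdeal ‹_›,
    ← AdicCompletion.ker_evalOneₐ_eq_map m hm]
  intro h
  have h' := RingHom.congr_fun (AdicCompletion.evalOneₐ_comp_algebraMap_eq_mk m) s
  exact hs (Ideal.Quotient.eq_zero_iff_mem.1 (h'.symm.trans h))

theorem mem_ringCosupport_of_isMaximal {R : Type u} [CommRing R] [IsNoetherianRing R]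
    (p : PrimeSpectrum R) (hp : p.asIdeal.IsMaximal) : p ∈ ringCosupport R := by
  refine ⟨0, ?_⟩
  by_contra h
  rw [not_nontrivial_iff_subsingleton] at h
  let φ : Localization.AtPrime p.asIdeal →ₐ[R] AdicCompletion p.asIdeal R :=
    IsLocalization.liftAlgHom (M := p.asIdeal.primeCompl) (f := Algebra.ofId _ _) fun s =>
      AdicCompletion.isUnit_algebraMap_of_notMem p.asIdeal.fg_of_isNoetherianRing s.2
  have h0 := eq_zero_of_isZero_ext_zero (R := R) (ModuleCat.isZero_of_subsingleton _)
    (ModuleCat.ofHom φ.toLinearMap)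
  have h1 : φ 1 = 0 := LinearMap.congr_fun (ModuleCat.hom_ext_iff.1 h0) 1
  rw [map_one] at h1
  have h2 := congrArg (AdicCompletion.evalOneₐ p.asIdeal) h1
  rw [map_one, map_zero] at h2
  exact one_ne_zero h2

theorem exists_lift_of_notMem_ringCosupport {R : Type u} [CommRing R] [IsDomain R]
    (p : PrimeSpectrum R) (hp : p.asIdeal = ⊥) (h : p ∉ ringCosupport R)
    (f : Localization.AtPrime p.asIdeal →ₗ[R] Localization.AtPrime p.asIdeal ⧸
      LinearMap.range (Algebra.linearMap R (Localization.AtPrime p.asIdeal))) :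
    ∃ g : Localization.AtPrime p.asIdeal →ₗ[R] Localization.AtPrime p.asIdeal,
      Submodule.mkQ _ ∘ₗ g = f := by
  have h1 : Subsingleton (((Ext R (ModuleCat.{u} R) 1).obj
      (op (ModuleCat.of R (Localization.AtPrime p.asIdeal)))).obj
      (ModuleCat.of R (AdicCompletion p.asIdeal R))) :=
    not_nontrivial_iff_subsingleton.1 fun h' => h ⟨1, h'⟩
  have hcomplete : IsAdicComplete p.asIdeal R := hp ▸ inferInstance
  let ι := Algebra.linearMap R (Localization.AtPrime p.asIdeal)
  let e := (AdicCompletion.ofLinearEquiv p.asIdeal R).symm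
  let S : ShortComplex (ModuleCat.{u} R) :=
    { X₁ := ModuleCat.of R (AdicCompletion p.asIdeal R)
      X₂ := ModuleCat.of R (Localization.AtPrime p.asIdeal)
      X₃ := ModuleCat.of R (Localization.AtPrime p.asIdeal ⧸ LinearMap.range ι)
      f := ModuleCat.ofHom (ι ∘ₗ e.toLinearMap)
      g := ModuleCat.ofHom (Submodule.mkQ _)
      zero := ModuleCat.hom_ext <| LinearMap.ext fun x =>
        (Submodule.Quotient.mk_eq_zero _).2 (LinearMap.mem_range_self ι (e x)) }
  have hι : Function.Injective ι :=
    IsLocalization.injective (Localization.AtPrime p.asIdeal) p.asIdeal.primeCompl_le_nonZeroDivisors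
  have hS : S.ShortExact :=
    { exact := by
        rw [ShortComplex.moduleCat_exact_iff_range_eq_ker]
        change LinearMap.range (ι ∘ₗ e.toLinearMap) = LinearMap.ker (Submodule.mkQ _)
        rw [LinearEquiv.range_comp, Submodule.ker_mkQ]
      mono_f := (ModuleCat.mono_iff_injective _).2 (hι.comp e.injective)
      epi_g := (ModuleCat.epi_iff_surjective _).2 (Submodule.mkQ_surjective _) }
  obtain ⟨g, hg⟩ := exists_lift_of_isZero_ext_one (R := R) hS
    (X := ModuleCat.of R (Localization.AtPrime p.asIdeal))
    (ModuleCat.isZero_of_subsingleton _) (ModuleCat.ofHom f)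
  exact ⟨g.hom, ModuleCat.hom_ext_iff.1 hg⟩

/-!
STATEMENT 2: A 1-dimensional commutative noetherian integral domain which is not a
complete local ring has full cosupport.
-/
theorem one_dimensional_domain_full_cosupport (R : Type u) [CommRing R] [IsDomain R]
    [IsNoetherianRing R] (hdim : ringKrullDim R = 1)
    (hnc : ¬ ∃ h : IsLocalRing R, IsAdicComplete (@IsLocalRing.maximalIdeal R _ h) R) :
    ∀ p : PrimeSpectrum R, p ∈ ringCosupport R := by
  have hdim1 : Ring.KrullDimLE 1 R := Order.krullDimLE_iff .. |>.2 hdim.le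
  have hf : ¬ IsField R := fun h => by
    simp [ringKrullDim_eq_zero_of_isField h] at hdim
  intro p
  by_cases hp : p.asIdeal = ⊥
  · by_contra h
    have : IsFractionRing R (Localization.AtPrime p.asIdeal) := by
      have := Localization.isLocalization (M := p.asIdeal.primeCompl)
      unfold IsFractionRing
      rwa [show nonZeroDivisors R = p.asIdeal.primeCompl by ext; simp [hp]]
    let : Field (Localization.AtPrime p.asIdeal) := IsFractionRing.toField R
    have hR := exists_forall_dvd_sub_of_lift (exists_lift_of_notMem_ringCosupport p hp h)
    have hlocal := isLocalRing_of_forall_exists_dvd_sub hf hR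
    have := isPrecomplete_maximalIdeal_of_forall_exists_dvd_sub hf hR
    exact hnc ⟨hlocal, { }⟩
  · exact mem_ringCosupport_of_isMaximal p (p.isPrime.isMaximal_of_ne_bot hp)
end

section
/- Let f : R → S be a finite homomorphism of commutative noetherian rings, let p be a prime ideal of R, and let X be any set. Write \widehat{R_p^{(X)}}^p for the pR_p-adic completion of the free R_p-module with basis X, and for a prime q of S write \widehat{S_q^{(X)}}^q for the qS_q-adic completion of the free S_q-module with basis X. Then there is an isomorphism of S-modules \widehat{R_p^{(X)}}^p ⊗_R S ≅ ⊕_q \widehat{S_q^{(X)}}^q, where the (finite) direct sum is over all prime ideals q of S with f^{-1}(q) = p. -/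
/-!
STATEMENT 5: Let `f : R → S` be a finite homomorphism of commutative noetherian rings
(here realized by an `R`-algebra structure on `S` with `S` module-finite over `R`),
let `p` be a prime of `R`, and let `X` be any set.  Then the `p`-adic completion of the
free `R_p`-module on `X`, tensored over `R` with `S`, is isomorphic as an `S`-module to
the direct sum, over the primes `q` of `S` contracting to `p`, of the `q`-adic
completions of the free `S_q`-modules on `X`.
-/

open TensorProduct DirectSum

universe u

namespace AdicCompletion

section Exactness

variable {R A B C : Type*} [CommRing R] {I : Ideal R} [AddCommGroup A] [Module R A]
  [AddCommGroup B] [Module R B] [AddCommGroup C] [Module R C]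

/-- Exactness of completion for modules that are not necessarily finite, under an Artin-Rees
hypothesis on the first map. -/
theorem exists_map_eq_of_map_eq_zero {f : A →ₗ[R] B} {g : B →ₗ[R] C} (hfg : Function.Exact f g)
    (hg : Function.Surjective g) {c : ℕ}
    (hf : ∀ n x, f x ∈ (I ^ (n + c) • ⊤ : Submodule R B) → x ∈ (I ^ n • ⊤ : Submodule R A))
    (y : AdicCompletion I B) (hy : map I g y = 0) : ∃ w, map I f w = y := by
  have key (n : ℕ) : ∃ a : A, Submodule.Quotient.mk (f a) = y.val n := by
    obtain ⟨b, hb⟩ := Submodule.Quotient.mk_surjective _ (y.val n)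
    have h1 : g b ∈ (I ^ n • ⊤ : Submodule R C) := by
      have := congrArg (fun z ↦ z.val n) hy
      rw [map_val_apply] at this
      simpa [← hb] using this
    have h2 : g b ∈ (I ^ n • ⊤ : Submodule R B).map g := by
      rwa [Submodule.map_smul'', Submodule.map_top, LinearMap.range_eq_top.mpr hg]
    obtain ⟨d, hd, hgd⟩ := h2
    obtain ⟨a, ha⟩ := (hfg (b - d)).mp (by simp [hgd])
    refine ⟨a, ?_⟩
    rw [← hb, Submodule.Quotient.eq, ha]
    simpa using hd
  choose a ha using key
  refine ⟨mk I A (AdicCauchySequence.mk I A (fun n ↦ a (n + c)) fun n ↦ ?_), ?_⟩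
  · rw [SModEq.sub_mem]
    apply hf
    have h := y.2 (show n + c ≤ n + 1 + c by lia)
    rw [← ha, ← ha] at h
    rw [map_sub, ← Submodule.Quotient.eq, ← h]
    rfl
  · ext n
    have h := y.2 (show n ≤ n + c by lia)
    rw [← ha] at h
    rw [map_mk, ← h]
    rfl

end Exactness

end AdicCompletion

section ArtinRees

variable {R N M : Type*} [CommRing R] [AddCommGroup N] [Module R N] [AddCommGroup M] [Module R M]

theorem TensorProduct.mem_smul_top_of_rTensor_mkQ_eq_zero (M : Type*) [AddCommGroup M] [Module R M]
    {J : Ideal R} {L : Submodule R N} (hL : L ≤ J • ⊤) {x : N ⊗[R] M}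
    (hx : L.mkQ.rTensor M x = 0) : x ∈ (J • ⊤ : Submodule R (N ⊗[R] M)) := by
  obtain ⟨y, rfl⟩ := (rTensor_exact M (LinearMap.exact_subtype_mkQ L) L.mkQ_surjective x).mp hx
  induction y with
  | zero => simp
  | add a b ha hb =>
    have h0 (a : L ⊗[R] M) : L.mkQ.rTensor M (L.subtype.rTensor M a) = 0 := by
      rw [← LinearMap.comp_apply, ← LinearMap.rTensor_comp]
      simp [(LinearMap.exact_subtype_mkQ L).linearMap_comp_eq_zero]
    rw [map_add]; exact add_mem (ha (h0 a)) (hb (h0 b))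
  | tmul l m =>
    have : ((TensorProduct.mk R N M).flip m) l.1 ∈
        (J • ⊤ : Submodule R N).map ((TensorProduct.mk R N M).flip m) := ⟨_, hL l.2, rfl⟩
    rw [Submodule.map_smul''] at this
    exact Submodule.smul_mono le_rfl le_top this

theorem TensorProduct.rTensor_mkQ_smul_top_eq_zero (M : Type*) [AddCommGroup M] [Module R M]
    {J : Ideal R} {x : N ⊗[R] M} (hx : x ∈ (J • ⊤ : Submodule R (N ⊗[R] M))) :
    (J • ⊤ : Submodule R N).mkQ.rTensor M x = 0 := by
  have : (J • ⊤ : Submodule R (N ⊗[R] M)) ≤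
      LinearMap.ker ((J • ⊤ : Submodule R N).mkQ.rTensor M) := by
    rw [Submodule.smul_le]
    intro r hr y _
    rw [LinearMap.mem_ker]
    induction y with
    | zero => simp
    | add a b ha hb => simp_all [smul_add]
    | tmul a b =>
      rw [smul_tmul', LinearMap.rTensor_tmul, Submodule.mkQ_apply,
        (Submodule.Quotient.mk_eq_zero _).mpr (Submodule.smul_mem_smul hr Submodule.mem_top), zero_tmul]
  exact this hx

/-- The Artin-Rees lemma after tensoring with a flat module. -/
theorem Ideal.exists_rTensor_mem_pow_smul_of_flat [IsNoetherianRing R] [Module.Finite R N]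
    (I : Ideal R) (K : Submodule R N) (M : Type*) [AddCommGroup M] [Module R M] [Module.Flat R M] :
    ∃ c : ℕ, ∀ n x, K.subtype.rTensor M x ∈ (I ^ (n + c) • ⊤ : Submodule R (N ⊗[R] M)) →
      x ∈ (I ^ n • ⊤ : Submodule R (K ⊗[R] M)) := by
  obtain ⟨c, hc⟩ := Ideal.exists_pow_inf_eq_pow_smul I K
  refine ⟨c, fun n x hx ↦ ?_⟩
  set L : Submodule R K := (I ^ (n + c) • ⊤ : Submodule R N).comap K.subtype with hLdef
  have hL : L ≤ I ^ n • ⊤ := by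
    intro y hy
    have h1 : (y : N) ∈ I ^ (n + c) • ⊤ ⊓ K := ⟨hy, y.2⟩
    rw [hc _ (by lia), Nat.add_sub_cancel] at h1
    have h2 : (y : N) ∈ I ^ n • K := Submodule.smul_mono le_rfl inf_le_right h1
    have h3 : (y : N) ∈ (I ^ n • ⊤ : Submodule R K).map K.subtype := by
      rwa [Submodule.map_smul'', Submodule.map_top, Submodule.range_subtype]
    obtain ⟨z, hz, hzy⟩ := h3
    rwa [← Subtype.ext hzy]
  let j : (K ⧸ L) →ₗ[R] N ⧸ (I ^ (n + c) • ⊤ : Submodule R N) := L.mapQ _ K.subtype le_rfl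
  have hj : Function.Injective j := by
    rw [← LinearMap.ker_eq_bot, Submodule.ker_mapQ, ← hLdef, Submodule.mkQ_map_self]
  refine mem_smul_top_of_rTensor_mkQ_eq_zero M hL
    (Module.Flat.rTensor_preserves_injective_linearMap (M := M) j hj ?_)
  have h := rTensor_mkQ_smul_top_eq_zero M hx
  rw [← LinearMap.comp_apply, ← LinearMap.rTensor_comp] at h ⊢
  rw [map_zero, ← h]
  rfl

end ArtinRees

namespace AdicCompletion

section TensorFlat

variable {R : Type*} [CommRing R] (I : Ideal R)

/-- The canonical map `N ⊗ M^ → (N ⊗ M)^`. -/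
noncomputable def tensorTo (N M : Type*) [AddCommGroup N] [Module R N] [AddCommGroup M]
    [Module R M] : N ⊗[R] AdicCompletion I M →ₗ[R] AdicCompletion I (N ⊗[R] M) :=
  TensorProduct.lift <| LinearMap.mk₂ R
    (fun n z ↦ map I (TensorProduct.mk R N M n) z)
    (fun n n' z ↦ by
      induction z using AdicCompletion.induction_on with | _ z
      ext k; simp)
    (fun r n z ↦ by
      induction z using AdicCompletion.induction_on with | _ z
      ext k; simp; rfl)
    (fun n z z' ↦ by simp)
    (fun r n z ↦ by simp)

variable {N N' M : Type*} [AddCommGroup N] [Module R N] [AddCommGroup M] [Module R M]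
  [AddCommGroup N'] [Module R N']

@[simp]
theorem tensorTo_tmul (n : N) (z : AdicCompletion I M) :
    tensorTo I N M (n ⊗ₜ z) = map I (TensorProduct.mk R N M n) z := rfl

theorem map_rTensor_tensorTo (h : N →ₗ[R] N') (x : N ⊗[R] AdicCompletion I M) :
    map I (h.rTensor M) (tensorTo I N M x) =
      tensorTo I N' M (h.rTensor (AdicCompletion I M) x) := by
  induction x with
  | zero => simp
  | add a b ha hb => simp [ha, hb]
  | tmul n z => simp [map_comp_apply]; rfl

theorem tensorTo_surjective [Module.Finite R N] : Function.Surjective (tensorTo I N M) := by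
  obtain ⟨d, π, hπ⟩ := Module.Finite.exists_fin' R N
  let σ : (Fin d → M) →ₗ[R] N ⊗[R] M :=
    ∑ i, (TensorProduct.mk R N M (π (Pi.single i 1))) ∘ₗ LinearMap.proj i
  have hσ : Function.Surjective σ := by
    intro x
    induction x with
    | zero => exact ⟨0, σ.map_zero⟩
    | add a b ha hb =>
      obtain ⟨a, rfl⟩ := ha
      obtain ⟨b, rfl⟩ := hb
      exact ⟨a + b, map_add _ _ _⟩
    | tmul n m =>
      obtain ⟨r, rfl⟩ := hπ n
      refine ⟨fun i ↦ r i • m, ?_⟩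
      conv_rhs => rw [pi_eq_sum_univ' r, map_sum, TensorProduct.sum_tmul]
      simp [σ, ← TensorProduct.smul_tmul', Pi.single]
  intro y
  obtain ⟨w, rfl⟩ := map_surjective I hσ y
  refine ⟨∑ i, π (Pi.single i 1) ⊗ₜ map I (LinearMap.proj i) w, ?_⟩
  induction w using AdicCompletion.induction_on with | _ w
  ext k
  simp [σ]

theorem tensorTo_injective_of_pi (d : ℕ) : Function.Injective (tensorTo I (Fin d → R) M) := by
  rw [injective_iff_map_eq_zero]
  intro x hx
  have hsum (x : (Fin d → R) ⊗[R] AdicCompletion I M) : x = ∑ i, (Pi.single i 1 : Fin d → R) ⊗ₜ[R]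
      TensorProduct.lid R _ ((LinearMap.proj i).rTensor (AdicCompletion I M) x) := by
    induction x with
    | zero => simp
    | add a b ha hb =>
      simp only [map_add, TensorProduct.tmul_add, Finset.sum_add_distrib]
      rw [← ha, ← hb]
    | tmul r z =>
      conv_lhs => rw [pi_eq_sum_univ' r, TensorProduct.sum_tmul]
      simp [← TensorProduct.smul_tmul', Pi.single]
  have hproj (i : Fin d) (x : (Fin d → R) ⊗[R] AdicCompletion I M) :
      map I ((TensorProduct.lid R M).toLinearMap ∘ₗ (LinearMap.proj i).rTensor M)
        (tensorTo I _ M x) =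
      TensorProduct.lid R _ ((LinearMap.proj i).rTensor (AdicCompletion I M) x) := by
    induction x with
    | zero => simp
    | add a b ha hb => simp [ha, hb]
    | tmul r z =>
      induction z using AdicCompletion.induction_on with | _ z
      ext k
      simp
      rfl
  rw [hsum x]
  simp [← hproj, hx]

theorem tensorTo_bijective [IsNoetherianRing R] [Module.Finite R N] [Module.Flat R M] :
    Function.Bijective (tensorTo I N M) := by
  refine ⟨?_, tensorTo_surjective I⟩
  obtain ⟨d, π, hπ⟩ := Module.Finite.exists_fin' R N
  have hex := LinearMap.exact_subtype_ker_map π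
  rw [injective_iff_map_eq_zero]
  intro x hx
  obtain ⟨x, rfl⟩ := LinearMap.rTensor_surjective _ hπ x
  rw [← map_rTensor_tensorTo] at hx
  obtain ⟨c, hc⟩ := Ideal.exists_rTensor_mem_pow_smul_of_flat I (LinearMap.ker π) M
  obtain ⟨w, hw⟩ := exists_map_eq_of_map_eq_zero (rTensor_exact M hex hπ)
    (LinearMap.rTensor_surjective _ hπ) hc _ hx
  obtain ⟨v, rfl⟩ := tensorTo_surjective I w
  rw [map_rTensor_tensorTo] at hw
  rw [← tensorTo_injective_of_pi I d hw]
  exact (rTensor_exact _ hex hπ).apply_apply_eq_zero v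

end TensorFlat

end AdicCompletion

namespace AdicCompletion

section MapAlg

variable {R S : Type*} [CommRing R] [CommRing S] [Algebra R S] {I : Ideal R} {J : Ideal S}
  {M N : Type*} [AddCommGroup M] [Module R M] [AddCommGroup N] [Module R N] [Module S N]
  [IsScalarTower R S N]

theorem _root_.LinearMap.apply_mem_pow_smul_top (h : I ≤ J.comap (algebraMap R S)) (g : M →ₗ[R] N)
    (n : ℕ) {x : M} (hx : x ∈ (I ^ n • ⊤ : Submodule R M)) :
    g x ∈ (J ^ n • ⊤ : Submodule S N) := by
  induction hx using Submodule.smul_induction_on' with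
  | smul r hr m _ =>
    rw [map_smul, ← algebraMap_smul S r (g m)]
    exact Submodule.smul_mem_smul
      (Ideal.le_comap_pow _ n (Ideal.pow_right_mono h n hr)) Submodule.mem_top
  | add a _ b _ ha hb => rw [map_add]; exact add_mem ha hb

/-- The map on quotients induced by a linear map over a change of rings. -/
noncomputable def mapAlgQuotient (h : I ≤ J.comap (algebraMap R S)) (g : M →ₗ[R] N) (n : ℕ) :
    (M ⧸ (I ^ n • ⊤ : Submodule R M)) →ₗ[R] N ⧸ (J ^ n • ⊤ : Submodule S N) :=
  (I ^ n • ⊤ : Submodule R M).liftQ ((J ^ n • ⊤ : Submodule S N).mkQ.restrictScalars R ∘ₗ g)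
    fun _ hx ↦ (Submodule.Quotient.mk_eq_zero _).mpr (LinearMap.apply_mem_pow_smul_top h g n hx)

/-- The map on adic completions induced by a linear map over a change of rings. -/
noncomputable def mapAlg (h : I ≤ J.comap (algebraMap R S)) (g : M →ₗ[R] N) :
    AdicCompletion I M →ₗ[R] AdicCompletion J N where
  toFun z := ⟨fun n ↦ mapAlgQuotient h g n (z.val n), by
    intro m n hmn
    have h1 := z.2 hmn
    obtain ⟨x, hx⟩ := Submodule.Quotient.mk_surjective _ (z.val n)
    rw [← hx] at h1
    dsimp only
    rw [← hx, ← h1]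
    rfl⟩
  map_add' a b := ext fun n ↦ map_add (mapAlgQuotient h g n) (a.val n) (b.val n)
  map_smul' r a := ext fun n ↦ map_smul (mapAlgQuotient h g n) r (a.val n)

theorem mapAlg_val_of_eq (h : I ≤ J.comap (algebraMap R S)) (g : M →ₗ[R] N)
    (z : AdicCompletion I M) (n : ℕ) (x : M) (hx : z.val n = Submodule.Quotient.mk x) :
    (mapAlg h g z).val n = Submodule.Quotient.mk (g x) := by
  change mapAlgQuotient h g n (z.val n) = _
  rw [hx]; rfl

/-- An adic completion is a product of adic completions (over another ring) if the filtration
is equivalent to the one induced from the product and the maps to the product are surjective at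
each level. -/
theorem mapAlg_pi_bijective {Q : Type*} {J : Q → Ideal S} {N : Q → Type*}
    [∀ q, AddCommGroup (N q)] [∀ q, Module R (N q)] [∀ q, Module S (N q)]
    [∀ q, IsScalarTower R S (N q)] (h : ∀ q, I ≤ (J q).comap (algebraMap R S))
    (g : ∀ q, M →ₗ[R] N q)
    (hsurj : ∀ (n : ℕ) (y : ∀ q, N q),
      ∃ x : M, ∀ q, g q x - y q ∈ (J q ^ n • ⊤ : Submodule S (N q)))
    {c : ℕ} (hker : ∀ (n : ℕ) (x : M), (∀ q, g q x ∈ (J q ^ (c * n) • ⊤ : Submodule S (N q))) →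
      x ∈ (I ^ n • ⊤ : Submodule R M)) :
    Function.Bijective (LinearMap.pi fun q ↦ mapAlg (h q) (g q)) := by
  have hker' (n : ℕ) (x : M)
      (hx : ∀ q, g q x ∈ (J q ^ ((c + 1) * n) • ⊤ : Submodule S (N q))) :
      x ∈ (I ^ n • ⊤ : Submodule R M) :=
    hker n x fun q ↦ Submodule.smul_mono_left (Ideal.pow_le_pow_right (by lia)) (hx q)
  have hle (n : ℕ) : n ≤ (c + 1) * n := by nlinarith
  constructor
  · rw [injective_iff_map_eq_zero]
    intro z hz
    ext n
    obtain ⟨x, hx⟩ := Submodule.Quotient.mk_surjective _ (z.val ((c + 1) * n))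
    have h1 := z.2 (hle n)
    rw [← hx] at h1
    rw [val_zero_apply, ← h1]
    refine (Submodule.Quotient.mk_eq_zero _).mpr (hker' n x fun q ↦ ?_)
    rw [← Submodule.Quotient.mk_eq_zero, ← mapAlg_val_of_eq (h q) (g q) z _ x hx.symm]
    have h2 := congrFun hz q
    rw [LinearMap.pi_apply] at h2
    rw [h2]; rfl
  · intro y
    have key (n : ℕ) : ∃ x : M, ∀ q, Submodule.Quotient.mk (g q x) = (y q).val n := by
      choose v hv using fun q ↦ Submodule.Quotient.mk_surjective _ ((y q).val n)
      obtain ⟨x, hx⟩ := hsurj n v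
      exact ⟨x, fun q ↦ by rw [← hv, Submodule.Quotient.eq]; exact hx q⟩
    choose x hx using key
    refine ⟨mk I M (AdicCauchySequence.mk I M (fun n ↦ x ((c + 1) * n)) fun n ↦ ?_), ?_⟩
    · rw [SModEq.sub_mem]
      refine hker' n _ fun q ↦ ?_
      have h1 := (y q).2 (show (c + 1) * n ≤ (c + 1) * (n + 1) by lia)
      rw [← hx, ← hx] at h1
      rw [map_sub, ← Submodule.Quotient.eq, ← h1]
      rfl
    · ext q n
      rw [LinearMap.pi_apply, mapAlg_val_of_eq (h q) (g q) _ n (x ((c + 1) * n)) rfl]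
      have h1 := (y q).2 (hle n)
      rw [← hx] at h1
      rw [← h1]; rfl

end MapAlg

end AdicCompletion

section Primes

variable {R S : Type*} [CommRing R] [CommRing S] [Algebra R S] [Algebra.IsIntegral R S]

theorem Ideal.exists_algebraMap_mem_of_forall_not_le {p : Ideal R} [p.IsPrime] {a : Ideal S}
    (ha : ∀ q : Ideal S, q.IsPrime → q.comap (algebraMap R S) = p → ¬ a ≤ q) :
    ∃ r ∉ p, algebraMap R S r ∈ a := by
  by_contra! H
  obtain ⟨q, hq, hqp, hle⟩ := Ideal.exists_ideal_over_prime_of_isIntegral p a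
    fun r hr ↦ by_contra fun hrp ↦ H r hrp hr
  exact ha q hqp hle hq

theorem Ideal.eq_of_comap_eq_comap_of_le {q q' : Ideal S} [q.IsPrime]
    (h : q.comap (algebraMap R S) = q'.comap (algebraMap R S)) (hle : q ≤ q') : q = q' := by
  by_contra hne
  exact (Ideal.IsIntegral.comap_lt_comap (R := R) (lt_of_le_of_ne hle hne)).ne h

theorem Ideal.exists_pow_map_le_map_of_comap_eq [IsNoetherianRing S] {p : Ideal R} {q : Ideal S}
    [q.IsPrime] (h : q.comap (algebraMap R S) = p) :
    ∃ c : ℕ, (q ^ c).map (algebraMap S (Localization.AtPrime q)) ≤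
      (p.map (algebraMap R S)).map (algebraMap S (Localization.AtPrime q)) := by
  simp_rw [Ideal.map_pow]
  refine Ideal.exists_pow_le_of_le_radical_of_fg ?_ (IsNoetherian.noetherian _)
  rw [Ideal.radical_eq_sInf, le_sInf_iff]
  rintro P ⟨hP, hPp⟩
  have h1 : P.comap (algebraMap S (Localization.AtPrime q)) ≤ q := by
    exact (Ideal.comap_mono (IsLocalRing.le_maximalIdeal hPp.ne_top)).trans
      (IsLocalization.AtPrime.under_maximalIdeal (Localization.AtPrime q) q).le
  have h2 : p.map (algebraMap R S) ≤ P.comap (algebraMap S (Localization.AtPrime q)) :=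
    Ideal.map_le_iff_le_comap.mp hP
  have h3 : P.comap (algebraMap S (Localization.AtPrime q)) = q := by
    refine Ideal.eq_of_comap_eq_comap_of_le (R := R) (le_antisymm (Ideal.comap_mono h1) ?_) h1
    rw [h]
    exact Ideal.map_le_iff_le_comap.mp h2
  exact Ideal.map_le_iff_le_comap.mpr h3.ge

end Primes

section Fiber

variable {R S : Type*} [CommRing R] [CommRing S] [Algebra R S] {p : Ideal R} [p.IsPrime]

/-- The canonical map `S ⊗ R_p → S_q` for a prime `q` lying over `p`. -/
noncomputable def Localization.AtPrime.baseChangeTo {q : Ideal S} [q.IsPrime]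
    (h : q.comap (algebraMap R S) = p) :
    S ⊗[R] Localization.AtPrime p →ₐ[S] Localization.AtPrime q :=
  Algebra.TensorProduct.lift (Algebra.ofId S _)
    (IsLocalization.liftAlgHom (M := p.primeCompl) (f := Algebra.ofId R (Localization.AtPrime q))
      fun r ↦ by
        rw [Algebra.ofId_apply, IsScalarTower.algebraMap_apply R S (Localization.AtPrime q)]
        exact IsLocalization.map_units (M := q.primeCompl) _
          ⟨algebraMap R S r, fun hr ↦ r.2 (h.le hr)⟩) fun _ _ ↦ .all _ _

open Localization.AtPrime

theorem Localization.AtPrime.baseChangeTo_tmul_one {q : Ideal S} [q.IsPrime]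
    (h : q.comap (algebraMap R S) = p) (s : S) :
    baseChangeTo h (s ⊗ₜ 1) = algebraMap S _ s := by
  rw [baseChangeTo, Algebra.TensorProduct.lift_tmul, map_one, mul_one]
  rfl

theorem Localization.AtPrime.algebraMap_mul_baseChangeTo_tmul_mk' {q : Ideal S} [q.IsPrime]
    (h : q.comap (algebraMap R S) = p) (s : S) (r : p.primeCompl) :
    algebraMap S (Localization.AtPrime q) (algebraMap R S r) *
      baseChangeTo h (s ⊗ₜ IsLocalization.mk' _ 1 r) = algebraMap S _ s := by
  rw [← IsScalarTower.algebraMap_apply R S (Localization.AtPrime q), ← Algebra.smul_def,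
    ← AlgHom.restrictScalars_apply R, ← map_smul, ← TensorProduct.tmul_smul, Algebra.smul_def,
    mul_comm, IsLocalization.mk'_spec, map_one, AlgHom.restrictScalars_apply,
    baseChangeTo_tmul_one]

theorem Localization.AtPrime.exists_smul_eq_tmul_one (t : S ⊗[R] Localization.AtPrime p) :
    ∃ r ∉ p, ∃ s : S, r • t = s ⊗ₜ 1 := by
  induction t with
  | zero => exact ⟨1, p.primeCompl.one_mem, 0, by simp⟩
  | add t t' ht ht' =>
    obtain ⟨r, hr, s, h⟩ := ht
    obtain ⟨r', hr', s', h'⟩ := ht'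
    refine ⟨r * r', p.primeCompl.mul_mem hr hr', r' • s + r • s', ?_⟩
    rw [smul_add, mul_comm, mul_smul, h, mul_comm, mul_smul, h', TensorProduct.add_tmul]
    rfl
  | tmul s x =>
    obtain ⟨a, b, rfl⟩ := IsLocalization.exists_mk'_eq p.primeCompl x
    refine ⟨b, b.2, a • s, ?_⟩
    rw [← TensorProduct.tmul_smul, Algebra.smul_def, mul_comm, IsLocalization.mk'_spec,
      Algebra.algebraMap_eq_smul_one, TensorProduct.tmul_smul]
    rfl

variable [Algebra.IsIntegral R S]

theorem Localization.AtPrime.exists_baseChangeTo_sub_mem {Q : Type*} [Finite Q] {q : Q → Ideal S}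
    [∀ i, (q i).IsPrime] (h : ∀ i, (q i).comap (algebraMap R S) = p)
    (hinj : Function.Injective q) (i₀ : Q) (k : ℕ) (s : Localization.AtPrime (q i₀)) :
    ∃ t : S ⊗[R] Localization.AtPrime p,
      baseChangeTo (h i₀) t - s ∈ ((q i₀) ^ k • ⊤ : Submodule S (Localization.AtPrime (q i₀))) ∧
      ∀ i ≠ i₀, baseChangeTo (h i) t ∈
        ((q i) ^ k • ⊤ : Submodule S (Localization.AtPrime (q i))) := by
  classical
  cases nonempty_fintype Q
  obtain ⟨a, ⟨b, hb⟩, rfl⟩ := IsLocalization.exists_mk'_eq (q i₀).primeCompl s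
  have hle (q' : Ideal S) (hq' : q'.IsPrime) (hqp : q'.comap (algebraMap R S) = p) (i : Q)
      (hi : q i ^ k ≤ q') : q i = q' :=
    Ideal.eq_of_comap_eq_comap_of_le (R := R) ((h i).trans hqp.symm) (hq'.le_of_pow_le hi)
  obtain ⟨r₁, hr₁, hr₁'⟩ := Ideal.exists_algebraMap_mem_of_forall_not_le (p := p)
    (a := q i₀ ^ k ⊔ Ideal.span {b}) fun q' hq' hqp hl ↦ by
      obtain ⟨h1, h2⟩ := sup_le_iff.mp hl
      refine hb ?_
      rw [hle q' hq' hqp i₀ h1]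
      exact (Ideal.span_singleton_le_iff_mem _).mp h2
  obtain ⟨r₂, hr₂, hr₂'⟩ := Ideal.exists_algebraMap_mem_of_forall_not_le (p := p)
    (a := q i₀ ^ k ⊔ ∏ i ∈ Finset.univ.erase i₀, q i ^ k) fun q' hq' hqp hl ↦ by
      obtain ⟨h1, h2⟩ := sup_le_iff.mp hl
      obtain ⟨i, hi, hi'⟩ := (hq'.prod_le).mp h2
      exact (Finset.mem_erase.mp hi).1
        (hinj ((hle q' hq' hqp i hi').trans (hle q' hq' hqp i₀ h1).symm))
  obtain ⟨f₁, hf₁, _, hb', hr₁eq⟩ := Submodule.mem_sup.mp hr₁'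
  obtain ⟨b', rfl⟩ := Ideal.mem_span_singleton'.mp hb'
  obtain ⟨f₂, hf₂, e, he, hr₂eq⟩ := Submodule.mem_sup.mp hr₂'
  let r : p.primeCompl := ⟨r₁, hr₁⟩ * ⟨r₂, hr₂⟩
  have hunit (i : Q) (r : p.primeCompl) :
      IsUnit (algebraMap S (Localization.AtPrime (q i)) (algebraMap R S r)) :=
    IsLocalization.map_units (M := (q i).primeCompl) _ ⟨_, fun hr ↦ r.2 ((h i).le hr)⟩
  refine ⟨(a * b' * e) ⊗ₜ IsLocalization.mk' _ 1 r, ?_, fun i hi ↦ ?_⟩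
  · rw [Ideal.smul_top_eq_map, Submodule.restrictScalars_mem]
    have hbu : IsUnit (algebraMap S (Localization.AtPrime (q i₀)) b) :=
      IsLocalization.map_units (M := (q i₀).primeCompl) _ ⟨b, hb⟩
    rw [← Ideal.unit_mul_mem_iff_mem _ ((hunit i₀ r).mul hbu)]
    have : algebraMap S (Localization.AtPrime (q i₀)) (algebraMap R S r) *
        algebraMap S (Localization.AtPrime (q i₀)) b *
        (baseChangeTo (h i₀) ((a * b' * e) ⊗ₜ IsLocalization.mk' _ 1 r) -
          IsLocalization.mk' _ a ⟨b, hb⟩) =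
        algebraMap S (Localization.AtPrime (q i₀)) (a * (b * b' * e - algebraMap R S (r₁ * r₂))) := by
      have h1 := algebraMap_mul_baseChangeTo_tmul_mk' (h i₀) (a * b' * e) r
      have h2 := IsLocalization.mk'_spec (Localization.AtPrime (q i₀)) a (⟨b, hb⟩ : (q i₀).primeCompl)
      dsimp only at h2
      have h3 : (r : R) = r₁ * r₂ := rfl
      rw [← h3, mul_sub, mul_sub a, map_sub (algebraMap S _)]
      congr 1
      · rw [mul_right_comm, h1, ← map_mul]; congr 1; ring
      · rw [mul_assoc, mul_comm _ (IsLocalization.mk' _ _ _), h2, ← map_mul, mul_comm]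
    rw [this]
    refine Ideal.mem_map_of_mem _ (Ideal.mul_mem_left _ _ ?_)
    have h4 : b * b' * e - algebraMap R S (r₁ * r₂) =
        -(f₁ * algebraMap R S r₂ + b' * b * f₂) := by
      rw [map_mul, ← hr₁eq, ← hr₂eq]; ring
    rw [h4]
    exact neg_mem (add_mem (Ideal.mul_mem_right _ _ hf₁) (Ideal.mul_mem_left _ _ hf₂))
  · rw [Ideal.smul_top_eq_map, Submodule.restrictScalars_mem,
      ← Ideal.unit_mul_mem_iff_mem _ (hunit i r), algebraMap_mul_baseChangeTo_tmul_mk']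
    refine Ideal.mem_map_of_mem _ (Ideal.mul_mem_left _ _ ?_)
    exact Ideal.le_of_dvd (Finset.dvd_prod_of_mem (fun i ↦ q i ^ k) (by simp [hi])) he

theorem Localization.AtPrime.mem_pow_smul_top_of_baseChangeTo_mem [IsNoetherianRing S] {Q : Type*}
    [Finite Q] {q : Q → Ideal S}
    [∀ i, (q i).IsPrime] (h : ∀ i, (q i).comap (algebraMap R S) = p)
    (hsurj : ∀ q' : Ideal S, q'.IsPrime → q'.comap (algebraMap R S) = p → ∃ i, q i = q') :
    ∃ c : ℕ, ∀ (n : ℕ) (t : S ⊗[R] Localization.AtPrime p),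
      (∀ i, baseChangeTo (h i) t ∈
        ((q i) ^ (c * n) • ⊤ : Submodule S (Localization.AtPrime (q i)))) →
      t ∈ (p ^ n • ⊤ : Submodule R (S ⊗[R] Localization.AtPrime p)) := by
  cases nonempty_fintype Q
  choose c hc using fun i ↦ Ideal.exists_pow_map_le_map_of_comap_eq (h i)
  refine ⟨∑ i, c i, fun n t ht ↦ ?_⟩
  obtain ⟨r, hr, s, hs⟩ := exists_smul_eq_tmul_one t
  obtain ⟨r', hr', h'⟩ := Ideal.exists_algebraMap_mem_of_forall_not_le (p := p)
    (a := Submodule.comap (LinearMap.mulRight S s) ((p ^ n).map (algebraMap R S))) fun q' hq' hqp hl ↦ by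
      obtain ⟨i, rfl⟩ := hsurj q' hq' hqp
      have h1 : algebraMap S (Localization.AtPrime (q i)) s ∈
          ((p ^ n).map (algebraMap R S)).map (algebraMap S (Localization.AtPrime (q i))) := by
        have h2 := ht i
        rw [Ideal.smul_top_eq_map, Submodule.restrictScalars_mem] at h2
        have h3 : algebraMap S (Localization.AtPrime (q i)) s =
            algebraMap S (Localization.AtPrime (q i)) (algebraMap R S r) * baseChangeTo (h i) t := by
          rw [← IsScalarTower.algebraMap_apply R S (Localization.AtPrime (q i)), ← Algebra.smul_def,
            ← AlgHom.restrictScalars_apply R, ← map_smul, hs,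
            AlgHom.restrictScalars_apply, baseChangeTo_tmul_one]
        rw [h3]
        refine Ideal.mul_mem_left _ _ ?_
        rw [Ideal.map_pow, Ideal.map_pow]
        refine Ideal.pow_right_mono (hc i) n ?_
        rw [← Ideal.map_pow, ← pow_mul]
        exact Ideal.map_mono (Ideal.pow_le_pow_right (Nat.mul_le_mul_right _
          (Finset.single_le_sum (fun _ _ ↦ Nat.zero_le _) (Finset.mem_univ i)))) h2
      obtain ⟨u, hu, hus⟩ :=
        (IsLocalization.algebraMap_mem_map_algebraMap_iff (q i).primeCompl _ _ _).mp h1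
      exact hu (hl hus)
  have h1 : algebraMap R S r' * s ∈ (p ^ n).map (algebraMap R S) := h'
  have h2 : (algebraMap R S r' * s) ⊗ₜ 1 ∈
      (p ^ n • ⊤ : Submodule R (S ⊗[R] Localization.AtPrime p)) := by
    rw [← Submodule.restrictScalars_mem R, ← Ideal.smul_top_eq_map] at h1
    have h3 := Submodule.mem_map_of_mem (f := (TensorProduct.mk R S (Localization.AtPrime p)).flip 1) h1
    rw [Submodule.map_smul''] at h3
    exact Submodule.smul_mono le_rfl le_top h3
  let v : S ⊗[R] Localization.AtPrime p :=
    1 ⊗ₜ IsLocalization.mk' _ 1 (⟨r', hr'⟩ * ⟨r, hr⟩ : p.primeCompl)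
  have h4 : t = LinearMap.mulLeft R v ((algebraMap R S r' * s) ⊗ₜ 1) := by
    rw [← Algebra.smul_def, ← TensorProduct.smul_tmul', ← hs, ← mul_smul, map_smul,
      LinearMap.mulLeft_apply, ← smul_mul_assoc, ← TensorProduct.tmul_smul, Algebra.smul_def, mul_comm (algebraMap R _ _)]
    have := IsLocalization.mk'_spec (Localization.AtPrime p) 1 (⟨r', hr'⟩ * ⟨r, hr⟩ : p.primeCompl)
    rw [Submonoid.coe_mul] at this
    rw [this, map_one, ← Algebra.TensorProduct.one_def, one_mul]
  have h5 := Submodule.mem_map_of_mem (f := LinearMap.mulLeft R v) h2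
  rw [Submodule.map_smul'', ← h4] at h5
  exact Submodule.smul_mono le_rfl le_top h5

end Fiber

theorem Finsupp.mem_smul_top_iff {S X N : Type*} [CommRing S] [AddCommGroup N] [Module S N]
    {J : Ideal S} {v : X →₀ N} :
    v ∈ (J • ⊤ : Submodule S (X →₀ N)) ↔ ∀ x, v x ∈ (J • ⊤ : Submodule S N) := by
  refine ⟨fun hv x ↦ ?_, fun hv ↦ ?_⟩
  · have h := Submodule.mem_map_of_mem (f := Finsupp.lapply x) hv
    rw [Submodule.map_smul''] at h
    exact Submodule.smul_mono le_rfl le_top h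
  · rw [← Finsupp.sum_single v]
    refine Submodule.sum_mem _ fun x _ ↦ ?_
    have h := Submodule.mem_map_of_mem (f := Finsupp.lsingle x) (hv x)
    rw [Submodule.map_smul''] at h
    exact Submodule.smul_mono le_rfl le_top h

section FreeModule

open Localization.AtPrime

variable {R S : Type*} [CommRing R] [CommRing S] [Algebra R S] {p : Ideal R} [p.IsPrime]

/-- The canonical map `S ⊗ R_p^(X) → S_q^(X)` for a prime `q` lying over `p`. -/
noncomputable def Finsupp.baseChangeTo (X : Type*) [DecidableEq X] {q : Ideal S} [q.IsPrime]
    (h : q.comap (algebraMap R S) = p) :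
    S ⊗[R] (X →₀ Localization.AtPrime p) →ₗ[S] X →₀ Localization.AtPrime q :=
  Finsupp.mapRange.linearMap (Localization.AtPrime.baseChangeTo h).toLinearMap ∘ₗ
    (TensorProduct.finsuppRight R S S (Localization.AtPrime p) X).toLinearMap

theorem Finsupp.baseChangeTo_apply {X : Type*} [DecidableEq X] {q : Ideal S} [q.IsPrime]
    (h : q.comap (algebraMap R S) = p) (w : S ⊗[R] (X →₀ Localization.AtPrime p)) (x : X) :
    Finsupp.baseChangeTo X h w x = Localization.AtPrime.baseChangeTo h
      (TensorProduct.finsuppRight R S S (Localization.AtPrime p) X w x) := rfl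

variable [Algebra.IsIntegral R S] (X : Type*) [DecidableEq X] {Q : Type*} [Finite Q] {q : Q → Ideal S}
  [∀ i, (q i).IsPrime]

theorem Finsupp.exists_baseChangeTo_sub_mem (h : ∀ i, (q i).comap (algebraMap R S) = p)
    (hinj : Function.Injective q) (k : ℕ) (y : ∀ i, X →₀ Localization.AtPrime (q i)) :
    ∃ w : S ⊗[R] (X →₀ Localization.AtPrime p), ∀ i, Finsupp.baseChangeTo X (h i) w - y i ∈
      ((q i) ^ k • ⊤ : Submodule S (X →₀ Localization.AtPrime (q i))) := by
  classical
  cases nonempty_fintype Q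
  have key (i₀ : Q) (v : X →₀ Localization.AtPrime (q i₀)) :
      ∃ w : S ⊗[R] (X →₀ Localization.AtPrime p), ∀ i,
        Finsupp.baseChangeTo X (h i) w -
          (Pi.single i₀ v : ∀ i, X →₀ Localization.AtPrime (q i)) i ∈
          ((q i) ^ k • ⊤ : Submodule S (X →₀ Localization.AtPrime (q i))) := by
    induction v using Finsupp.induction_linear with
    | zero => exact ⟨0, fun i ↦ by simp⟩
    | add v v' hv hv' =>
      obtain ⟨w, hw⟩ := hv
      obtain ⟨w', hw'⟩ := hv'
      refine ⟨w + w', fun i ↦ ?_⟩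
      rw [Pi.single_add, Pi.add_apply, map_add, add_sub_add_comm]
      exact add_mem (hw i) (hw' i)
    | single x s =>
      obtain ⟨t, ht, ht'⟩ := Localization.AtPrime.exists_baseChangeTo_sub_mem h hinj i₀ k s
      refine ⟨(TensorProduct.finsuppRight R S S (Localization.AtPrime p) X).symm
        (Finsupp.single x t), fun i ↦ ?_⟩
      rw [Finsupp.mem_smul_top_iff]
      intro x'
      rw [Finsupp.sub_apply, Finsupp.baseChangeTo_apply, LinearEquiv.apply_symm_apply]
      obtain rfl | hi := eq_or_ne i i₀
      · rw [Pi.single_eq_same]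
        obtain rfl | hx := eq_or_ne x x'
        · simpa using ht
        · simp [Finsupp.single_eq_of_ne' hx]
      · rw [Pi.single_eq_of_ne hi, Finsupp.zero_apply, sub_zero]
        obtain rfl | hx := eq_or_ne x x'
        · simpa using ht' i hi
        · simp [Finsupp.single_eq_of_ne' hx]
  choose w hw using fun i ↦ key i (y i)
  refine ⟨∑ i, w i, fun i ↦ ?_⟩
  have hy : y i = ∑ j, (Pi.single j (y j) : ∀ i, X →₀ Localization.AtPrime (q i)) i := by
    rw [← Finset.sum_apply, Finset.univ_sum_single]
  rw [hy, map_sum, ← Finset.sum_sub_distrib]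
  exact Submodule.sum_mem _ fun j _ ↦ hw j i

theorem Finsupp.mem_pow_smul_top_of_baseChangeTo_mem [IsNoetherianRing S]
    (h : ∀ i, (q i).comap (algebraMap R S) = p)
    (hsurj : ∀ q' : Ideal S, q'.IsPrime → q'.comap (algebraMap R S) = p → ∃ i, q i = q') :
    ∃ c : ℕ, ∀ (n : ℕ) (w : S ⊗[R] (X →₀ Localization.AtPrime p)),
      (∀ i, Finsupp.baseChangeTo X (h i) w ∈
        ((q i) ^ (c * n) • ⊤ : Submodule S (X →₀ Localization.AtPrime (q i)))) →
      w ∈ (p ^ n • ⊤ : Submodule R (S ⊗[R] (X →₀ Localization.AtPrime p))) := by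
  obtain ⟨c, hc⟩ := Localization.AtPrime.mem_pow_smul_top_of_baseChangeTo_mem h hsurj
  refine ⟨c, fun n w hw ↦ ?_⟩
  let e := (TensorProduct.finsuppRight R S S (Localization.AtPrime p) X).restrictScalars R
  have h1 : e w ∈ (p ^ n • ⊤ : Submodule R (X →₀ S ⊗[R] Localization.AtPrime p)) := by
    rw [Finsupp.mem_smul_top_iff]
    exact fun x ↦ hc n _ fun i ↦ Finsupp.mem_smul_top_iff.mp (hw i) x
  have h2 := Submodule.mem_map_of_mem (f := e.symm.toLinearMap) h1
  rw [Submodule.map_smul''] at h2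
  have h3 := Submodule.smul_mono le_rfl le_top h2
  rwa [LinearEquiv.coe_coe, LinearEquiv.symm_apply_apply] at h3

/-- If the `q i` are the distinct primes of `S` over `p`, then the completion of the free
`R_p`-module on `X`, tensored with `S`, is the product of the completions of the free
`S_(q i)`-modules on `X`. -/
theorem AdicCompletion.exists_bijective_tensor_free [IsNoetherianRing R] [IsNoetherianRing S]
    [Module.Finite R S] (h : ∀ i, (q i).comap (algebraMap R S) = p)
    (hinj : Function.Injective q)
    (hsurj : ∀ q' : Ideal S, q'.IsPrime → q'.comap (algebraMap R S) = p → ∃ i, q i = q') :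
    ∃ Φ : (S ⊗[R] AdicCompletion p (X →₀ Localization.AtPrime p)) →ₗ[S]
      ∀ i, AdicCompletion (q i) (X →₀ Localization.AtPrime (q i)), Function.Bijective Φ := by
  obtain ⟨c, hc⟩ := Finsupp.mem_pow_smul_top_of_baseChangeTo_mem X h hsurj
  have : Module.Flat R (X →₀ Localization.AtPrime p) :=
    have : Module.Flat R (Localization.AtPrime p) := IsLocalization.flat _ p.primeCompl
    Module.Flat.trans R (Localization.AtPrime p) _
  let f (i : Q) := (Finsupp.baseChangeTo X (h i)).restrictScalars R
  let Γ := LinearMap.pi fun i ↦ AdicCompletion.mapAlg (h i).ge (f i)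
  have hΓ : Function.Bijective Γ := AdicCompletion.mapAlg_pi_bijective (fun i ↦ (h i).ge) f
    (Finsupp.exists_baseChangeTo_sub_mem X h hinj) hc
  let Φ := LinearMap.liftBaseChange S
    (LinearMap.pi fun i ↦ AdicCompletion.mapAlg (h i).ge (f i ∘ₗ TensorProduct.mk R S _ 1))
  have hΦ : ⇑Φ = Γ ∘ AdicCompletion.tensorTo p S (X →₀ Localization.AtPrime p) := by
    funext y
    induction y with
    | zero => simp
    | add a b ha hb => simp_all
    | tmul s z =>
      funext i
      refine AdicCompletion.ext fun n ↦ ?_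
      obtain ⟨m, hm⟩ := Submodule.Quotient.mk_surjective _ (z.val n)
      have h1 : (AdicCompletion.tensorTo p S _ (s ⊗ₜ z)).val n =
          Submodule.Quotient.mk (s ⊗ₜ[R] m) := by
        rw [AdicCompletion.tensorTo_tmul, AdicCompletion.map_val_apply, ← hm]
        rfl
      have h2 := AdicCompletion.mapAlg_val_of_eq (h i).ge (f i) _ n _ h1
      have h3 := AdicCompletion.mapAlg_val_of_eq (h i).ge
        (f i ∘ₗ TensorProduct.mk R S _ 1) z n m hm.symm
      refine Eq.trans ?_ h2.symm
      rw [LinearMap.liftBaseChange_tmul]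
      refine (congrArg (s • ·) h3).trans ?_
      rw [← Submodule.Quotient.mk_smul]
      congr 1
      simp only [f, LinearMap.comp_apply, LinearMap.restrictScalars_apply, TensorProduct.mk_apply]
      rw [← map_smul, TensorProduct.smul_tmul', smul_eq_mul, mul_one]
  exact ⟨Φ, hΦ ▸ hΓ.comp (AdicCompletion.tensorTo_bijective p)⟩

end FreeModule

theorem completion_free_module_base_change (R S : Type u) [CommRing R] [CommRing S]
    [IsNoetherianRing R] [IsNoetherianRing S] [Algebra R S] [Module.Finite R S]
    (p : PrimeSpectrum R) (X : Type u) :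
    Nonempty
      ((S ⊗[R] AdicCompletion p.asIdeal (X →₀ Localization.AtPrime p.asIdeal)) ≃ₗ[S]
        ⨁ q : {q : PrimeSpectrum S // PrimeSpectrum.comap (algebraMap R S) q = p},
          AdicCompletion q.1.asIdeal (X →₀ Localization.AtPrime q.1.asIdeal)) := by
  classical
  let Q := {q : PrimeSpectrum S // PrimeSpectrum.comap (algebraMap R S) q = p}
  have h (i : Q) : i.1.asIdeal.comap (algebraMap R S) = p.asIdeal :=
    congrArg PrimeSpectrum.asIdeal i.2
  have hinj : Function.Injective fun i : Q ↦ i.1.asIdeal := fun i j hij ↦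
    Subtype.ext (PrimeSpectrum.ext hij)
  have : Finite Q :=
    have := (Algebra.QuasiFinite.finite_primesOver (S := S) p.asIdeal).to_subtype
    Finite.of_injective (β := p.asIdeal.primesOver S)
      (fun i ↦ ⟨i.1.asIdeal, i.1.2, ⟨(h i).symm⟩⟩) fun i j hij ↦ hinj (congrArg Subtype.val hij)
  have := Fintype.ofFinite Q
  obtain ⟨Φ, hΦ⟩ := AdicCompletion.exists_bijective_tensor_free X h hinj
    fun q' hq' hqp ↦ ⟨⟨⟨q', hq'⟩, PrimeSpectrum.ext hqp⟩, rfl⟩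
  exact ⟨(LinearEquiv.ofBijective Φ hΦ).trans
    (DirectSum.linearEquivFunOnFintype S Q _).symm⟩
end

section
/- Let k be a field and let T = k[[t]][x] be the polynomial ring in x over the power series ring k[[t]]. Let p = (x), which is a prime ideal of T since T/(x) ≅ k[[t]] is a domain. Then Ext^i_T(T_p, Λ^p T) = 0 for all i ≥ 0; that is, the prime (x) does not lie in the cosupport of T. -/
open CategoryTheory Opposite

universe u

/-- `M` is derived complete along `t`: every telescope `s n = a n + t • s (n + 1)` has exactly one
solution, to be thought of as `s n = ∑ i, t ^ i • a (n + i)`. -/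
def HasUniqueTelescopes {R : Type*} [Semiring R] (t : R) (M : Type*) [AddCommMonoid M]
    [Module R M] : Prop :=
  ∀ a : ℕ → M, ∃! s : ℕ → M, ∀ n, s n = a n + t • s (n + 1)

theorem HasUniqueTelescopes.linearMap {R : Type*} [CommRing R] {t : R} {M : Type*}
    [AddCommGroup M] [Module R M] (hM : HasUniqueTelescopes t M) (P : Type*) [AddCommGroup P]
    [Module R P] : HasUniqueTelescopes t (P →ₗ[R] M) := by
  intro a
  choose s hs hu using fun x : P => hM fun n => a n x
  refine ⟨fun n =>
    { toFun := fun x => s x n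
      map_add' := fun x y => ?_
      map_smul' := fun r x => ?_ }, fun n => LinearMap.ext fun x => hs x n, fun s' hs' => ?_⟩
  · refine (congrFun (hu (x + y) (fun n => s x n + s y n) fun n => ?_) n).symm
    simp only [map_add, smul_add]
    nth_rewrite 1 [hs x n, hs y n]
    abel
  · refine (congrFun (hu (r • x) (fun n => r • s x n) fun n => ?_) n).symm
    simp only [map_smul]
    nth_rewrite 1 [hs x n]
    rw [smul_add, smul_comm]
  · funext n
    ext x
    exact congrFun (hu x (fun n => s' n x) fun n => by
      simpa using LinearMap.congr_fun (hs' n) x) n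

theorem HasUniqueTelescopes.hom {R : Type u} [CommRing R] {t : R} {M : ModuleCat.{u} R}
    (hM : HasUniqueTelescopes t M) (P : ModuleCat.{u} R) : HasUniqueTelescopes t (P ⟶ M) := by
  intro a
  obtain ⟨s, hs, hu⟩ := hM.linearMap P fun n => (a n).hom
  refine ⟨fun n => ModuleCat.ofHom (s n), fun n => ?_, fun s' hs' => ?_⟩
  · ext x
    exact LinearMap.congr_fun (hs n) x
  · funext n
    ext x
    exact LinearMap.congr_fun (congrFun (hu (fun n => (s' n).hom) fun n => by
      ext x
      exact LinearMap.congr_fun (congrArg ModuleCat.Hom.hom (hs' n)) x) n) x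

theorem Homotopy.dNext_hom_eq_d_comp {C : Type*} [Category* C] [Preadditive C]
    {P Q : ChainComplex C ℕ} (h : ∀ i j, P.X i ⟶ Q.X j) {i j : ℕ}
    (hij : (ComplexShape.up ℕ).prev i = j) :
    dNext i h = P.d i j ≫ h j i := by
  subst hij
  cases i with
  | zero => simp
  | succ i => rw [dNext_succ_chainComplex, CochainComplex.prev_nat_succ]

/-- If `t` acts invertibly on `N` while every telescope along `t` has a unique solution in `M`,
then all `Ext` modules from `N` to `M` vanish. -/
theorem subsingleton_Ext_of_hasUniqueTelescopes {R : Type u} [CommRing R] {t : R}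
    {N M : ModuleCat.{u} R} (hM : HasUniqueTelescopes t M) (u : N ⟶ N)
    (hu : t • u = 𝟙 N) (i : ℕ) :
    Subsingleton (((Ext R (ModuleCat.{u} R) i).obj (op N)).obj M) := by
  let P := projectiveResolution N
  let φ : P.complex ⟶ P.complex := ProjectiveResolution.lift u P P
  have hφ : φ ≫ P.π = P.π ≫ (ChainComplex.single₀ _).map u :=
    ProjectiveResolution.lift_commutes u P P
  let H : Homotopy (𝟙 P.complex) (t • φ) :=
    ProjectiveResolution.liftHomotopy (𝟙 N) _ _ (by simp) (by
      rw [Linear.smul_comp, hφ, ← hu]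
      ext
      simp only [← Linear.comp_smul, HomologicalComplex.comp_f, HomologicalComplex.smul_f_apply,
        ChainComplex.single₀_map_f_zero]
      rfl)
  rw [← ModuleCat.isZero_iff_subsingleton]
  refine Limits.IsZero.of_iso ?_ (P.isoExt i M)
  rw [← HomologicalComplex.exactAt_iff_isZero_homology, HomologicalComplex.exactAt_iff' _
    _ i (i + 1) rfl (by simp), ShortComplex.moduleCat_exact_iff]
  intro (f : P.complex.X i ⟶ M) (hf : P.complex.d (i + 1) i ≫ f = 0)
  let F : ℕ → (P.complex.X i ⟶ M) := fun n => Nat.rec f (fun _ g => φ.f i ≫ g) n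
  have hF : ∀ n, P.complex.d (i + 1) i ≫ F n = 0 := by
    intro n
    induction n with
    | zero => exact hf
    | succ n ih =>
      change P.complex.d (i + 1) i ≫ φ.f i ≫ F n = 0
      rw [← φ.comm_assoc, ih, Limits.comp_zero]
  set j := (ComplexShape.up ℕ).prev i with hj
  have key : ∀ n, F n = P.complex.d i j ≫ H.hom j i ≫ F n + t • F (n + 1) := by
    intro n
    have h1 := congrArg (· ≫ F n) (H.comm i)
    simp only [Homotopy.dNext_hom_eq_d_comp H.hom hj.symm, Homotopy.prevD_chainComplex,
      Preadditive.add_comp, Category.assoc, hF n, Limits.comp_zero, add_zero,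
      HomologicalComplex.id_f, Category.id_comp] at h1
    refine h1.trans ?_
    congr 1
    exact Linear.smul_comp _ _ _ _ _ _
  obtain ⟨s, hs, -⟩ := hM.hom _ fun n => H.hom j i ≫ F n
  refine ⟨s 0, ?_⟩
  obtain ⟨w, -, hw⟩ := hM.hom _ fun n => P.complex.d i j ≫ H.hom j i ≫ F n
  have h1 := hw F key
  have h2 := hw (fun n => P.complex.d i j ≫ s n) fun n => by
    rw [← Linear.comp_smul, ← Preadditive.comp_add, ← hs n]
  exact congrFun (h2.trans h1.symm) 0

theorem HasUniqueTelescopes.adicCompletion {R : Type*} [CommRing R] {t : R} {I : Ideal R}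
    {M : Type*} [AddCommGroup M] [Module R M]
    (h : ∀ N : ℕ, HasUniqueTelescopes t (M ⧸ (I ^ N • ⊤ : Submodule R M))) :
    HasUniqueTelescopes t (AdicCompletion I M) := by
  intro a
  choose s hs hu using fun N => h N fun n => (a n).val N
  refine ⟨fun n => ⟨fun N => s N n, fun {m N} hmN => ?_⟩, fun n => ?_, fun s' hs' => ?_⟩
  · refine congrFun (hu m (fun n => AdicCompletion.transitionMap I M hmN (s N n)) fun n => ?_) n
    have := congrArg (AdicCompletion.transitionMap I M hmN) (hs N n)
    rwa [map_add, map_smul, AdicCompletion.transitionMap_comp_eval_apply] at this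
  · ext N
    exact hs N n
  · funext n
    ext N
    exact congrFun (hu N (fun n => (s' n).val N) fun n => congrArg (fun x => x.val N) (hs' n)) n

theorem PowerSeries.eq_zero_of_eq_X_mul_succ {k : Type*} [CommRing k] {c : ℕ → PowerSeries k}
    (hc : ∀ n, c n = PowerSeries.X * c (n + 1)) (n : ℕ) : c n = 0 := by
  ext r
  induction r generalizing n with
  | zero => rw [hc]; simp
  | succ r ih => rw [hc, PowerSeries.coeff_succ_X_mul, ih]; simp

theorem PowerSeries.exists_eq_add_X_mul_succ {k : Type*} [CommRing k] (a : ℕ → PowerSeries k) :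
    ∃ s : ℕ → PowerSeries k, ∀ n, s n = a n + PowerSeries.X * s (n + 1) := by
  refine ⟨fun n => PowerSeries.mk fun r =>
    ∑ m ∈ Finset.range (r + 1), PowerSeries.coeff (r - m) (a (n + m)), fun n => ?_⟩
  ext r
  cases r with
  | zero => simp
  | succ r =>
    rw [map_add, PowerSeries.coeff_succ_X_mul, PowerSeries.coeff_mk, PowerSeries.coeff_mk,
      Finset.sum_range_succ', add_comm]
    simp [add_assoc, add_comm 1]

open Polynomial in
theorem hasUniqueTelescopes_quotient_span_X_pow (k : Type*) [CommRing k] (N : ℕ) :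
    HasUniqueTelescopes (C (PowerSeries.X : PowerSeries k))
      ((PowerSeries k)[X] ⧸ ((Ideal.span {(X : (PowerSeries k)[X])}) ^ N • ⊤ :
        Submodule (PowerSeries k)[X] (PowerSeries k)[X])) := by
  have hmem : ∀ p : (PowerSeries k)[X],
      p ∈ ((Ideal.span {(X : (PowerSeries k)[X])}) ^ N • ⊤ :
        Submodule (PowerSeries k)[X] (PowerSeries k)[X]) ↔ ∀ j < N, p.coeff j = 0 := fun p => by
    rw [smul_eq_mul, Ideal.mul_top, Ideal.span_singleton_pow, Ideal.mem_span_singleton,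
      X_pow_dvd_iff]
  intro a
  choose p hp using fun n => Submodule.Quotient.mk_surjective _ (a n)
  choose c hc using fun j => PowerSeries.exists_eq_add_X_mul_succ fun n => (p n).coeff j
  refine existsUnique_of_exists_of_unique ⟨fun n => Submodule.Quotient.mk
    (∑ j ∈ Finset.range N, monomial j (c j n)), fun n => ?_⟩ fun s s' hs hs' => ?_
  · rw [← hp, ← Submodule.Quotient.mk_smul, ← Submodule.Quotient.mk_add, Submodule.Quotient.eq,
      hmem]
    intro j hj
    have := hc j n
    simp only [coeff_sub, coeff_add, smul_eq_mul, coeff_C_mul, finsetSum_coeff, coeff_monomial,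
      Finset.sum_ite_eq', Finset.mem_range, hj, if_true]
    rw [← this, sub_self]
  · choose q hq using fun n => Submodule.Quotient.mk_surjective _ (s n - s' n)
    have hrec : ∀ n, ∀ j < N, (q n).coeff j = PowerSeries.X * (q (n + 1)).coeff j := by
      intro n
      have h1 : s n - s' n = C (PowerSeries.X : PowerSeries k) • (s (n + 1) - s' (n + 1)) := by
        nth_rewrite 1 [hs n, hs' n]
        rw [smul_sub]
        abel
      rw [← hq, ← hq, ← Submodule.Quotient.mk_smul, Submodule.Quotient.eq, hmem] at h1
      intro j hj
      simpa [sub_eq_zero] using h1 j hj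
    funext n
    rw [← sub_eq_zero, ← hq, Submodule.Quotient.mk_eq_zero, hmem]
    exact fun j hj =>
      PowerSeries.eq_zero_of_eq_X_mul_succ (c := fun n => (q n).coeff j) (fun n => hrec n j hj) n

/-!
STATEMENT 12: For a field `k`, let `T = k[[t]][x]` and `p = (x)`.  Then `p` is a prime
ideal of `T` (since `T/(x) ≅ k[[t]]` is a domain) and `Ext^i_T(T_p, Λ^p T) = 0` for all
`i ≥ 0`, i.e. `p` does not lie in the cosupport of `T`.
-/
theorem span_X_not_in_cosupport (k : Type) [Field k] :
    (Ideal.span {(Polynomial.X : Polynomial (PowerSeries k))}).IsPrime ∧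
      ∀ p : PrimeSpectrum (Polynomial (PowerSeries k)),
        p.asIdeal = Ideal.span {(Polynomial.X : Polynomial (PowerSeries k))} →
          p ∉ ringCosupport (Polynomial (PowerSeries k)) := by
  refine ⟨(Ideal.span_singleton_prime Polynomial.X_ne_zero).2 Polynomial.prime_X, ?_⟩
  rintro p hp ⟨i, hi⟩
  refine not_subsingleton_iff_nontrivial.2 hi ?_
  have ht : Polynomial.C (PowerSeries.X : PowerSeries k) ∈ p.asIdeal.primeCompl := by
    intro h
    rw [SetLike.mem_coe, hp, Ideal.mem_span_singleton, Polynomial.X_dvd_iff,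
      Polynomial.coeff_C_zero] at h
    exact PowerSeries.X_ne_zero h
  obtain ⟨v, hv⟩ := (IsLocalization.map_units (Localization.AtPrime p.asIdeal)
    ⟨_, ht⟩).exists_right_inv
  refine subsingleton_Ext_of_hasUniqueTelescopes
    (t := Polynomial.C (PowerSeries.X : PowerSeries k))
    (HasUniqueTelescopes.adicCompletion fun N => ?_)
    (ModuleCat.ofHom (LinearMap.mulLeft _ v)) ?_ i
  · rw [hp]
    exact hasUniqueTelescopes_quotient_span_X_pow k N
  · ext x
    exact (Algebra.smul_def (A := Localization.AtPrime p.asIdeal) _ _).trans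
      ((mul_assoc _ _ _).symm.trans ((congrArg (· * _) hv).trans (one_mul _)))
end

section
/- Let k be a field and let T = k[[t]][x] be the polynomial ring in x over the power series ring k[[t]]. Then for every integer n ≥ 1, the principal ideal generated by 1 − x·t^n is a maximal ideal of T. -/
/-!
STATEMENT 13: For a field `k` and `T = k[[t]][x]`, for every `n ≥ 1` the principal
ideal generated by `1 - x·tⁿ` is a maximal ideal of `T`.
-/

/-- If every nonzero element of a domain `R` divides a power of `r`, then inverting `r` already
gives the fraction field of `R`, so `r * X - 1` generates a maximal ideal of `R[X]`. -/
theorem Polynomial.span_C_mul_X_sub_one_isMaximal {R : Type*} [CommRing R] [IsDomain R] {r : R}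
    (hr : r ≠ 0) (h : ∀ a : R, a ≠ 0 → ∃ m : ℕ, a ∣ r ^ m) :
    (Ideal.span {(Polynomial.C r * Polynomial.X - 1 : Polynomial R)}).IsMaximal := by
  let A := AdjoinRoot (Polynomial.C r * Polynomial.X - 1)
  have : IsLocalization.Away r A := IsLocalization.adjoin_inv r
  have : IsFractionRing R A :=
    IsLocalization.of_le_of_exists_dvd (Submonoid.powers r) (nonZeroDivisors R)
      (powers_le_nonZeroDivisors_of_noZeroDivisors hr) fun a ha => by
        obtain ⟨m, hm⟩ := h a (nonZeroDivisors.ne_zero ha)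
        exact ⟨r ^ m, ⟨m, rfl⟩, hm⟩
  exact Ideal.Quotient.maximal_of_isField _ (IsFractionRing.toField R (K := A)).toIsField

theorem PowerSeries.exists_dvd_X_pow {k : Type*} [Field k] {f : PowerSeries k} (hf : f ≠ 0) :
    ∃ m : ℕ, f ∣ PowerSeries.X ^ m := by
  obtain ⟨m, u, hu⟩ :=
    IsDiscreteValuationRing.associated_pow_irreducible hf PowerSeries.X_irreducible
  exact ⟨m, u, hu.symm⟩

theorem span_one_sub_X_mul_t_pow_isMaximal (k : Type) [Field k] :
    ∀ n : ℕ, 1 ≤ n →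
      (Ideal.span {(1 - Polynomial.X * Polynomial.C (PowerSeries.X ^ n) :
        Polynomial (PowerSeries k))}).IsMaximal := by
  intro n hn
  rw [← Ideal.span_singleton_neg, neg_sub, mul_comm]
  refine Polynomial.span_C_mul_X_sub_one_isMaximal (pow_ne_zero n PowerSeries.X_ne_zero)
    fun f hf => ?_
  obtain ⟨m, hm⟩ := PowerSeries.exists_dvd_X_pow hf
  refine ⟨m, hm.trans ?_⟩
  rw [← pow_mul]
  exact pow_dvd_pow _ (Nat.le_mul_of_pos_left m hn)
end
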